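/- arXiv:2103.02468 — 2 statements merged into one kernel-verified Lean document; each statement's English description precedes it below -/
import Mathlib

section
/- There are universal constants c, C > 0 such that the following holds. Let H be a finite-dimensional complex Hilbert space and |ψ⟩ = Σ_i √λ_i |u_i⟩|u_i⟩ ∈ H ⊗ H a unit vector with λ_i ≥ 0 and {|u_i⟩} orthonormal. Then there is a finite set Λ, a probability distribution μ on Λ, and for each λ ∈ Λ a subspace H_λ ⊆ H and the maximally entangled state |ψ_λ⟩ on H_λ ⊗ H_λ ⊆ H ⊗ H such that, letting ρ be the reduced density of |ψ⟩ on the first factor and ρ_λ the reduced density of |ψ_λ⟩ (the totally mixed state on H_λ), one has ρ = E_{λ∼μ}[ρ_λ]. Moreover, for any finite set 𝒜 and any POVM {A_a}_{a∈𝒜} on H there exist, for each λ, a projective measurement {A^λ_a}_{a∈𝒜} supported on H_λ such that E_{λ∼μ} Σ_a ‖(A_a − A^λ_a) ⊗ Id |ψ_λ⟩‖² ≤ C (1 − Σ_a ⟨ψ| A_a ⊗ (A_a)^T |ψ⟩)^c, where the transpose is with respect to {|u_i⟩}. The set Λ, the distribution μ and the states |ψ_λ⟩ depend only on |ψ⟩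 and not on the POVM. -/
open scoped Kronecker ComplexOrder
open Matrix MeasureTheory

attribute [local instance] Matrix.normedAddCommGroup Matrix.normedSpace

namespace AlmostSync

/-- Frobenius norm of a complex matrix. -/
noncomputable def frob {n : Type*} [Fintype n] (X : Matrix n n ℂ) : ℝ :=
  Real.sqrt ((Xᴴ * X).trace.re)

/-- `⟨ψ| M |ψ⟩` (real part). -/
noncomputable def ev {m : Type*} [Fintype m] (ψ : m → ℂ) (M : Matrix m m ℂ) : ℝ :=
  (star ψ ⬝ᵥ M.mulVec ψ).re

/-- Squared `ℓ²` norm of a vector. -/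
noncomputable def nsq {m : Type*} [Fintype m] (v : m → ℂ) : ℝ :=
  ∑ p, Complex.normSq (v p)

/-- A probability distribution on a finite set. -/
def IsDist {𝒳 : Type*} [Fintype 𝒳] (ν : 𝒳 → ℝ) : Prop :=
  (∀ x, 0 ≤ ν x) ∧ ∑ x, ν x = 1

/-- A POVM on a finite-dimensional space. -/
def IsPOVM {n 𝒜 : Type*} [Fintype n] [DecidableEq n] [Fintype 𝒜]
    (A : 𝒜 → Matrix n n ℂ) : Prop :=
  (∀ a, (A a).PosSemidef) ∧ ∑ a, A a = 1

/-- A projective measurement. -/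
def IsProjMeas {n 𝒜 : Type*} [Fintype n] [DecidableEq n] [Fintype 𝒜]
    (A : 𝒜 → Matrix n n ℂ) : Prop :=
  (∀ a, (A a)ᴴ = A a ∧ A a * A a = A a) ∧ ∑ a, A a = 1

/-- A projective measurement supported on the range of a projection `P`. -/
def IsProjMeasOn {n 𝒜 : Type*} [Fintype n] [DecidableEq n] [Fintype 𝒜]
    (P : Matrix n n ℂ) (A : 𝒜 → Matrix n n ℂ) : Prop :=
  (∀ a, (A a)ᴴ = A a ∧ A a * A a = A a ∧ P * A a = A a ∧ A a * P = A a) ∧ ∑ a, A a = P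

/-- The state `Σ_i √(lam i) |i⟩|i⟩` (standard basis as eigenbasis). -/
noncomputable def canonPsi {n : Type*} [DecidableEq n] (lam : n → ℝ) : n × n → ℂ :=
  fun p => if p.1 = p.2 then (Real.sqrt (lam p.1) : ℂ) else 0

/-- The maximally entangled state `d^{-1/2} Σ_i |i⟩|i⟩`. -/
noncomputable def mePsi (d : ℕ) : Fin d × Fin d → ℂ :=
  fun p => if p.1 = p.2 then ((Real.sqrt d)⁻¹ : ℂ) else 0

/-- Default to synchronicity `E_{x∼ν} Σ_{a≠b} ⟨ψ| A^x_a ⊗ B^x_b |ψ⟩`. -/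
noncomputable def deltaSync {n₁ n₂ 𝒳 𝒜 : Type*} [Fintype n₁] [Fintype n₂]
    [Fintype 𝒳] [Fintype 𝒜] [DecidableEq 𝒜]
    (ν : 𝒳 → ℝ) (ψ : n₁ × n₂ → ℂ)
    (A : 𝒳 → 𝒜 → Matrix n₁ n₁ ℂ) (B : 𝒳 → 𝒜 → Matrix n₂ n₂ ℂ) : ℝ :=
  ∑ x, ν x * ∑ a, ∑ b, if a = b then 0 else ev ψ (A x a ⊗ₖ B x b)

/-- The correlation induced by a strategy. -/
noncomputable def corr {n₁ n₂ 𝒳 𝒴 𝒜 ℬ : Type*} [Fintype n₁] [Fintype n₂]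
    (ψ : n₁ × n₂ → ℂ) (A : 𝒳 → 𝒜 → Matrix n₁ n₁ ℂ) (B : 𝒴 → ℬ → Matrix n₂ n₂ ℂ)
    (x : 𝒳) (y : 𝒴) (a : 𝒜) (b : ℬ) : ℝ :=
  ev ψ (A x a ⊗ₖ B y b)

/-- Success probability of a strategy in a nonlocal game. -/
noncomputable def winProb {n₁ n₂ 𝒳 𝒴 𝒜 ℬ : Type*} [Fintype n₁] [Fintype n₂]
    [Fintype 𝒳] [Fintype 𝒴] [Fintype 𝒜] [Fintype ℬ]
    (ν : 𝒳 × 𝒴 → ℝ) (D : 𝒳 → 𝒴 → 𝒜 → ℬ → Bool)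
    (ψ : n₁ × n₂ → ℂ) (A : 𝒳 → 𝒜 → Matrix n₁ n₁ ℂ) (B : 𝒴 → ℬ → Matrix n₂ n₂ ℂ) : ℝ :=
  ∑ x, ∑ y, ν (x, y) * ∑ a, ∑ b, (if D x y a b then (1:ℝ) else 0) * ev ψ (A x a ⊗ₖ B y b)

/-- Reduced density operator on the first tensor factor. -/
noncomputable def rhoA {n₁ n₂ : Type*} [Fintype n₂] (ψ : n₁ × n₂ → ℂ) : Matrix n₁ n₁ ℂ :=
  Matrix.of fun i i' => ∑ j, ψ (i, j) * star (ψ (i', j))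

/-- Reduced density operator on the second tensor factor. -/
noncomputable def rhoB {n₁ n₂ : Type*} [Fintype n₁] (ψ : n₁ × n₂ → ℂ) : Matrix n₂ n₂ ℂ :=
  Matrix.of fun j j' => ∑ i, ψ (i, j) * star (ψ (i, j'))

/-- Transpose with respect to the orthonormal basis given by the columns of a unitary `U`. -/
noncomputable def transposeB {n : Type*} [Fintype n] (U X : Matrix n n ℂ) : Matrix n n ℂ :=
  U * (Uᴴ * X * U)ᵀ * Uᴴ

/-- Canonical purification `Σ_k √(lam k) |u_k⟩|u_k⟩` of `U * diagonal lam * Uᴴ`,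
where `u_k` is the `k`-th column of `U`. -/
noncomputable def purif {n : Type*} [Fintype n] (U : Matrix n n ℂ) (lam : n → ℝ) :
    n × n → ℂ :=
  fun p => ∑ k, (Real.sqrt (lam k) : ℂ) * U p.1 k * U p.2 k

/-- Spectral projection of a Hermitian matrix onto eigenvalues `≥ t`
(the indicator of `[t, ∞)` applied via the functional calculus). -/
noncomputable def specProj {n : Type*} [Fintype n] [DecidableEq n] {M : Matrix n n ℂ}
    (hM : M.IsHermitian) (t : ℝ) : Matrix n n ℂ :=
  hM.cfc (fun x => if t ≤ x then 1 else 0)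

/-- Spectral projection at level `t` of the diagonal matrix with entries `lam`. -/
noncomputable def Pdiag {n : Type*} [Fintype n] [DecidableEq n] (lam : n → ℝ) (t : ℝ) :
    Matrix n n ℂ :=
  Matrix.diagonal (fun i => if t ≤ lam i then 1 else 0)

/-- `ψ` is the maximally entangled state on `H' ⊗ H'` where `H'` is the range of the
projection `P`. -/
def IsMaxEntOn {n : Type*} [Fintype n] [DecidableEq n] (ψ : n × n → ℂ)
    (P : Matrix n n ℂ) : Prop :=
  ∃ (S : Finset n) (v : n → n → ℂ),
    (∀ i ∈ S, ∀ j ∈ S, star (v i) ⬝ᵥ v j = if i = j then 1 else 0) ∧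
    P = ∑ i ∈ S, Matrix.vecMulVec (v i) (star (v i)) ∧
    ψ = fun p => ((Real.sqrt S.card)⁻¹ : ℂ) * ∑ i ∈ S, v i p.1 * v i p.2

lemma rhoA_isHermitian {n₁ n₂ : Type*} [Fintype n₂] (ψ : n₁ × n₂ → ℂ) :
    (rhoA ψ).IsHermitian := by
  refine Matrix.ext fun i j => ?_
  simp only [rhoA, Matrix.conjTranspose_apply, Matrix.of_apply, star_sum, star_mul',
    star_star]
  exact Finset.sum_congr rfl fun k _ => mul_comm _ _

lemma rhoB_isHermitian {n₁ n₂ : Type*} [Fintype n₁] (ψ : n₁ × n₂ → ℂ) :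
    (rhoB ψ).IsHermitian := by
  refine Matrix.ext fun i j => ?_
  simp only [rhoB, Matrix.conjTranspose_apply, Matrix.of_apply, star_sum, star_mul',
    star_star]
  exact Finset.sum_congr rfl fun k _ => mul_comm _ _

/-- A nonnegative function is a nonnegative combination of indicators of a chain of sets. -/
theorem exists_nested_supports {ι : Type*} [Fintype ι] [DecidableEq ι] (lam : ι → ℝ)
    (hlam : ∀ i, 0 ≤ lam i) :
    ∃ (N : ℕ) (w : Fin N → ℝ) (S : Fin N → Finset ι), (∀ l, 0 ≤ w l) ∧
      ∀ i j, ∑ l, (if i ∈ S l ∧ j ∈ S l then w l else 0) = min (lam i) (lam j) := by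
  generalize hk : (Finset.univ.filter fun i => lam i ≠ 0).card = k
  induction k using Nat.strong_induction_on generalizing lam with
  | _ k ih =>
  set T := Finset.univ.filter fun i => lam i ≠ 0 with hT
  have hmem : ∀ i, i ∈ T ↔ lam i ≠ 0 := fun i => by simp [hT]
  rcases T.eq_empty_or_nonempty with h0 | hne
  · have h : ∀ i, lam i = 0 := fun i => by
      by_contra hi
      have := (hmem i).2 hi
      simp [h0] at this
    exact ⟨0, fun _ => 0, fun _ => ∅, by simp, by simp [h]⟩
  obtain ⟨m, hmT, hm⟩ := T.exists_min_image lam hne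
  set lam' : ι → ℝ := fun i => lam i - if i ∈ T then lam m else 0 with hl'
  have hz : ∀ i, i ∉ T → lam i = 0 := fun i hi => by simpa [hmem] using hi
  have hlam' : ∀ i, 0 ≤ lam' i := fun i => by
    by_cases hi : i ∈ T
    · simpa [hl', hi] using hm i hi
    · simp [hl', hi, hlam i]
  have hcard : (Finset.univ.filter fun i => lam' i ≠ 0).card < k := by
    rw [← hk]
    refine Finset.card_lt_card ⟨fun i hi => ?_, fun hsub => ?_⟩
    · by_contra hiT
      simp [hl', hiT, hz i hiT] at hi
    · have := hsub hmT
      simp [hl', hmT] at this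
  obtain ⟨N, w, S, hw, hS⟩ := ih _ hcard lam' hlam' rfl
  refine ⟨N + 1, Fin.cons (lam m) w, Fin.cons T S, fun l => ?_, fun i j => ?_⟩
  · refine Fin.cases ?_ (fun l => ?_) l
    · simpa using hlam m
    · simpa using hw l
  · rw [Fin.sum_univ_succ]
    simp only [Fin.cons_zero, Fin.cons_succ]
    rw [hS i j]
    by_cases hi : i ∈ T <;> by_cases hj : j ∈ T
    · simp only [hl', hi, hj, and_self, if_true]
      rw [min_sub_sub_right]; ring
    · simp [hl', hi, hj, hz j hj, hm i hi, hlam i]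
    · simp [hl', hi, hj, hz i hi, hm j hj, hlam j]
    · simp [hl', hi, hj]

theorem exists_card_eq_sum_sq_le {J : Type*} [Fintype J] (β : J → ℝ) (d : ℕ)
    (h0 : ∀ j, 0 ≤ β j) (h1 : ∀ j, β j ≤ 1) (hs : ∑ j, β j = d) :
    ∃ T : Finset J, T.card = d ∧ ∑ j, β j ^ 2 ≤ ∑ j ∈ T, β j := by
  classical
  have hd : d ≤ (Finset.univ : Finset J).card := by
    have : (d : ℝ) ≤ ∑ _j : J, (1 : ℝ) := hs ▸ Finset.sum_le_sum fun j _ => h1 j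
    simpa using this
  obtain ⟨T, hT, hmax⟩ := (Finset.powersetCard d (Finset.univ : Finset J)).exists_max_image
    (fun T => ∑ j ∈ T, β j) (Finset.powersetCard_nonempty.2 hd)
  have hTc : T.card = d := (Finset.mem_powersetCard.1 hT).2
  have hex : ∀ i ∈ T, ∀ j ∉ T, β j ≤ β i := fun i hi j hj => by
    have hj' : j ∉ T.erase i := fun h => hj (Finset.mem_of_mem_erase h)
    have := hmax (insert j (T.erase i)) (Finset.mem_powersetCard.2 ⟨Finset.subset_univ _, by
      rw [Finset.card_insert_of_notMem hj', Finset.card_erase_of_mem hi, ← hTc]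
      have := Finset.card_pos.2 ⟨i, hi⟩
      omega⟩)
    rw [Finset.sum_insert hj', ← Finset.add_sum_erase T β hi] at this
    linarith
  obtain ⟨θ, hθT, hθ⟩ : ∃ θ, (∀ i ∈ T, θ ≤ β i) ∧ ∀ j ∉ T, β j ≤ θ := by
    rcases T.eq_empty_or_nonempty with h | h
    · exact ⟨1, by simp [h], fun j _ => h1 j⟩
    · obtain ⟨m, hm, hmin⟩ := T.exists_min_image β h
      exact ⟨β m, hmin, fun j hj => hex m hm j hj⟩
  refine ⟨T, hTc, ?_⟩
  have hA : ∑ j ∈ T, θ * (1 - β j) ≤ ∑ j ∈ T, β j * (1 - β j) :=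
    Finset.sum_le_sum fun j hj =>
      mul_le_mul_of_nonneg_right (hθT j hj) (sub_nonneg.2 (h1 j))
  have hB : ∑ j ∈ Tᶜ, β j * β j ≤ ∑ j ∈ Tᶜ, θ * β j :=
    Finset.sum_le_sum fun j hj =>
      mul_le_mul_of_nonneg_right (hθ j (Finset.mem_compl.1 hj)) (h0 j)
  rw [← Finset.sum_add_sum_compl T] at hs ⊢
  simp only [mul_sub, mul_one, Finset.sum_sub_distrib, Finset.sum_const, nsmul_eq_mul, hTc,
    ← Finset.mul_sum] at hA hB
  simp only [pow_two]
  have : θ * ∑ j ∈ T, β j + θ * ∑ j ∈ Tᶜ, β j = d * θ := by rw [← mul_add, hs, mul_comm]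
  linarith

theorem sum_inner_map_map {ι E : Type*} [Fintype ι]
    [NormedAddCommGroup E] [InnerProductSpace ℂ E] [FiniteDimensional ℂ E]
    (T R : E →ₗ[ℂ] E) (u v : OrthonormalBasis ι ℂ E) :
    ∑ k, inner ℂ (T (u k)) (R (u k)) = ∑ k, inner ℂ (T (v k)) (R (v k)) := by
  have := (LinearMap.trace_eq_sum_inner (LinearMap.adjoint T ∘ₗ R) u).symm.trans
    (LinearMap.trace_eq_sum_inner (LinearMap.adjoint T ∘ₗ R) v)
  simpa [LinearMap.adjoint_inner_right] using this

/-- A family with Bessel constant one is correlated with some orthonormal basis: in terms of the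
associated contraction `T`, `‖T‖₂² ≤ ‖T‖₁`. -/
theorem exists_orthonormalBasis_le_sum_re_inner {ι E : Type*} [Fintype ι]
    [NormedAddCommGroup E] [InnerProductSpace ℂ E] [FiniteDimensional ℂ E]
    (b : OrthonormalBasis ι ℂ E) (y : ι → E)
    (hy : ∀ x, ∑ k, ‖inner ℂ (y k) x‖ ^ 2 ≤ ‖x‖ ^ 2) :
    ∃ w : OrthonormalBasis ι ℂ E, ∑ k, ‖y k‖ ^ 2 ≤ ∑ k, (inner ℂ (y k) (w k)).re := by
  classical
  set T : E →ₗ[ℂ] E := b.toBasis.constr ℂ y with hT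
  have hTb : ∀ k, T (b k) = y k := fun k => by
    rw [hT, ← b.coe_toBasis, Module.Basis.constr_basis]
  set G : E →ₗ[ℂ] E := LinearMap.adjoint T ∘ₗ T with hG
  have hGs : G.IsSymmetric := fun x z => by
    simp [hG, LinearMap.adjoint_inner_left, LinearMap.adjoint_inner_right]
  have hcard : Module.finrank ℂ E = Fintype.card ι := Module.finrank_eq_card_basis b.toBasis
  set e := (hGs.eigenvectorBasis hcard).reindex (Fintype.equivFin ι).symm with he
  have heig : ∀ i, ∃ c : ℝ, G (e i) = (c : ℂ) • e i := fun i =>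
    ⟨hGs.eigenvalues hcard (Fintype.equivFin ι i), by
      simp [he]⟩
  have horth : ∀ i j, i ≠ j → inner ℂ (T (e i)) (T (e j)) = 0 := fun i j hij => by
    obtain ⟨c, hc⟩ := heig i
    rw [← LinearMap.adjoint_inner_left]
    change inner ℂ (G (e i)) (e j) = 0
    rw [hc, inner_smul_left, orthonormal_iff_ite.1 e.orthonormal, if_neg hij, mul_zero]
  set f : ι → E := fun i => ((‖T (e i)‖⁻¹ : ℝ) : ℂ) • T (e i) with hf
  set s : Set ι := {i | T (e i) ≠ 0} with hs
  have hfo : Orthonormal ℂ (s.domRestrict f) := by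
    refine ⟨fun i => ?_, fun i j hij => ?_⟩
    · have : ‖T (e i)‖ ≠ 0 := norm_ne_zero_iff.2 i.2
      simp [Set.domRestrict_apply, hf, norm_smul, this]
    · have : (i : ι) ≠ j := fun h => hij (Subtype.ext h)
      simp [Set.domRestrict_apply, hf, inner_smul_left, inner_smul_right, horth _ _ this]
  obtain ⟨f', hf'⟩ := hfo.exists_orthonormalBasis_extension_of_card_eq hcard
  have hinner : ∀ i, inner ℂ (T (e i)) (f' i) = (‖T (e i)‖ : ℂ) := fun i => by
    by_cases hi : T (e i) = 0
    · simp [hi]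
    · have : (‖T (e i)‖ : ℂ) ≠ 0 := by exact_mod_cast norm_ne_zero_iff.2 hi
      rw [hf' i hi, hf, inner_smul_right, inner_self_eq_norm_sq_to_K]
      push_cast
      field_simp
      rfl
  have hcontr : ∀ x, ‖T x‖ ≤ ‖x‖ := fun x => by
    have h1 : ‖LinearMap.adjoint T (T x)‖ ^ 2 ≤ ‖T x‖ ^ 2 := by
      rw [← b.sum_sq_norm_inner_right]
      refine le_of_eq_of_le (Finset.sum_congr rfl fun k _ => ?_) (hy (T x))
      rw [LinearMap.adjoint_inner_right, hTb]
    have h2 : ‖LinearMap.adjoint T (T x)‖ ≤ ‖T x‖ :=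
      (pow_le_pow_iff_left₀ (norm_nonneg _) (norm_nonneg _) two_ne_zero).1 h1
    have h3 : ‖T x‖ ^ 2 ≤ ‖T x‖ * ‖x‖ := by
      have h4 : ‖T x‖ ^ 2 = ‖inner ℂ (LinearMap.adjoint T (T x)) x‖ := by
        rw [LinearMap.adjoint_inner_left, inner_self_eq_norm_sq_to_K]
        simp
      rw [h4]
      exact (norm_inner_le_norm _ _).trans (mul_le_mul_of_nonneg_right h2 (norm_nonneg _))
    rcases (norm_nonneg (T x)).eq_or_lt with h | h
    · rw [← h]; exact norm_nonneg _
    · rw [pow_two] at h3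
      exact le_of_mul_le_mul_left h3 h
  set W : E ≃ₗᵢ[ℂ] E := e.equiv f' (Equiv.refl ι) with hW
  have hWe : ∀ i, W (e i) = f' i := fun i => by simp [hW]
  refine ⟨b.map W, ?_⟩
  have hL : ∑ k, ‖y k‖ ^ 2 = ∑ i, ‖T (e i)‖ ^ 2 := by
    have h := congrArg Complex.re (sum_inner_map_map T T b e)
    simp only [inner_self_eq_norm_sq_to_K, hTb] at h
    simpa [← Complex.ofReal_pow] using h
  have hR : ∑ k, (inner ℂ (y k) (b.map W k)).re = ∑ i, ‖T (e i)‖ := by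
    have h := congrArg Complex.re (sum_inner_map_map T W.toLinearEquiv.toLinearMap b e)
    simpa [hTb, hWe, hinner] using h
  rw [hL, hR]
  refine Finset.sum_le_sum fun i _ => ?_
  have h1 : ‖T (e i)‖ ≤ 1 := by simpa using hcontr (e i)
  nlinarith [norm_nonneg (T (e i))]

theorem sum_normSq_eq_trace {ι : Type*} [Fintype ι] (X : Matrix ι ι ℂ) :
    ∑ i, ∑ j, Complex.normSq (X i j) = (Xᴴ * X).trace.re := by
  rw [Finset.sum_comm]
  simp [Matrix.trace, Matrix.mul_apply, Complex.normSq_apply]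

theorem toEuclideanLin_eigenvectorBasis {ι : Type*} [Fintype ι] [DecidableEq ι]
    {M : Matrix ι ι ℂ} (hM : M.IsHermitian) (k : ι) :
    toEuclideanLin M (hM.eigenvectorBasis k) =
      (hM.eigenvalues k : ℂ) • hM.eigenvectorBasis k := by
  ext i
  simpa using congrFun (hM.mulVec_eigenvectorBasis k) i

theorem re_inner_toEuclideanLin {ι : Type*} [Fintype ι] [DecidableEq ι] {M : Matrix ι ι ℂ}
    (hM : M.IsHermitian) (x : EuclideanSpace ℂ ι) :
    (inner ℂ x (toEuclideanLin M x)).re =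
      ∑ k, hM.eigenvalues k * ‖inner ℂ (hM.eigenvectorBasis k) x‖ ^ 2 := by
  have hs : (toEuclideanLin M).IsSymmetric := isSymmetric_toEuclideanLin_iff.2 hM
  rw [← hM.eigenvectorBasis.sum_inner_mul_inner, Complex.re_sum]
  refine Finset.sum_congr rfl fun k _ => ?_
  rw [← hs, toEuclideanLin_eigenvectorBasis hM, inner_smul_left, Complex.conj_ofReal,
    mul_left_comm, Complex.re_ofReal_mul, ← inner_conj_symm, mul_comm, ← Complex.normSq_eq_conj_mul_self, Complex.ofReal_re,
    Complex.normSq_eq_norm_sq, mul_comm]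

theorem sum_normSq_eq_sum_eigenvalues_sq {ι : Type*} [Fintype ι] [DecidableEq ι]
    {M : Matrix ι ι ℂ} (hM : M.IsHermitian) :
    ∑ i, ∑ j, Complex.normSq (M i j) = ∑ k, hM.eigenvalues k ^ 2 := by
  have h := congrArg Complex.re (sum_inner_map_map (toEuclideanLin M) (toEuclideanLin M)
    (EuclideanSpace.basisFun ι ℂ) hM.eigenvectorBasis)
  have hn : ∀ x : EuclideanSpace ℂ ι, (inner ℂ x x).re = ‖x‖ ^ 2 := fun x =>
    inner_self_eq_norm_sq (𝕜 := ℂ) x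
  have hc : ∀ j, ‖toEuclideanLin M (EuclideanSpace.basisFun ι ℂ j)‖ ^ 2 =
      ∑ i, Complex.normSq (M i j) := fun j => by
    simp [EuclideanSpace.norm_sq_eq, Complex.normSq_eq_norm_sq, toLpLin_apply]
  simp only [Complex.re_sum, hn, hc] at h
  rw [Finset.sum_comm, h]
  refine Finset.sum_congr rfl fun k _ => ?_
  rw [toEuclideanLin_eigenvectorBasis hM]
  simp [norm_smul]

/-- Rounding of a POVM to a projective measurement: if the POVM `B` on a `d`-dimensional space
has `∑ₐ ‖Bₐ‖² ≥ d - ε` in Frobenius norm, it is within squared distance `3 ε` of a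
projective measurement. -/
theorem exists_isProjMeas_near {ι 𝒜 : Type*} [Fintype ι] [DecidableEq ι] [Fintype 𝒜]
    (B : 𝒜 → Matrix ι ι ℂ) (hB : IsPOVM B) :
    ∃ Q : 𝒜 → Matrix ι ι ℂ, IsProjMeas Q ∧
      ∑ a, ∑ i, ∑ j, Complex.normSq ((B a - Q a) i j) ≤
        3 * (Fintype.card ι - ∑ a, ∑ i, ∑ j, Complex.normSq (B a i j)) := by
  classical
  have hH : ∀ a, (B a).IsHermitian := fun a => (hB.1 a).1
  set β : 𝒜 × ι → ℝ := fun p => (hH p.1).eigenvalues p.2 with hβ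
  set v : 𝒜 × ι → EuclideanSpace ℂ ι := fun p => (hH p.1).eigenvectorBasis p.2 with hv
  have h0 : ∀ p, 0 ≤ β p := fun p => (hB.1 p.1).eigenvalues_nonneg p.2
  have hq : ∀ a x, (inner ℂ x (toEuclideanLin (B a) x)).re =
      ∑ k, β (a, k) * ‖inner ℂ (v (a, k)) x‖ ^ 2 := fun a x =>
    re_inner_toEuclideanLin (hH a) x
  have hone : ∀ x, ∑ p, β p * ‖inner ℂ (v p) x‖ ^ 2 = ‖x‖ ^ 2 := fun x => by
    rw [Fintype.sum_prod_type]
    simp only [← hq]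
    rw [← Complex.re_sum, ← inner_sum, ← LinearMap.sum_apply, ← map_sum, hB.2]
    simp [inner_self_eq_norm_sq_to_K, ← Complex.ofReal_pow]
  have hle : ∀ p x, β p * ‖inner ℂ (v p) x‖ ^ 2 ≤
      (inner ℂ x (toEuclideanLin (B p.1) x)).re := fun p x => by
    rw [hq]
    exact Finset.single_le_sum (f := fun k => β (p.1, k) * ‖inner ℂ (v (p.1, k)) x‖ ^ 2)
      (fun k _ => mul_nonneg (h0 _) (sq_nonneg _)) (Finset.mem_univ p.2)
  have h1 : ∀ p, β p ≤ 1 := fun p => by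
    have h := Finset.single_le_sum (f := fun q => β q * ‖inner ℂ (v q) (v p)‖ ^ 2)
      (fun q _ => mul_nonneg (h0 _) (sq_nonneg _)) (Finset.mem_univ p)
    rw [hone] at h
    simpa [hv] using h
  have hsum : ∑ p, β p = (Fintype.card ι : ℕ) := by
    rw [Fintype.sum_prod_type]
    have h : ∀ a, ∑ k, β (a, k) = (B a).trace.re := fun a => by
      rw [(hH a).trace_eq_sum_eigenvalues]
      simp [hβ]
    simp only [h]
    rw [← Complex.re_sum, ← trace_sum, hB.2]
    simp
  obtain ⟨T, hTc, hT⟩ := exists_card_eq_sum_sq_le β _ h0 h1 hsum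
  have e : ι ≃ T := Fintype.equivOfCardEq (by simp [hTc])
  have hsumT : ∀ g : 𝒜 × ι → ℝ, ∑ k, g (e k) = ∑ p ∈ T, g p := fun g => by
    rw [e.sum_comp (fun p : T => g p), Finset.sum_coe_sort]
  have hyn : ∀ k x, ‖inner ℂ ((Real.sqrt (β (e k)) : ℂ) • v (e k)) x‖ ^ 2 =
      β (e k) * ‖inner ℂ (v (e k)) x‖ ^ 2 := fun k x => by
    rw [inner_smul_left, norm_mul, mul_pow]
    simp [Real.sq_sqrt (h0 _)]
  obtain ⟨w, hw⟩ := exists_orthonormalBasis_le_sum_re_inner (EuclideanSpace.basisFun ι ℂ)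
    (fun k => (Real.sqrt (β (e k)) : ℂ) • v (e k)) (fun x => by
      simp only [hyn]
      rw [hsumT (fun p => β p * ‖inner ℂ (v p) x‖ ^ 2), ← hone x]
      exact Finset.sum_le_sum_of_subset_of_nonneg (Finset.subset_univ _)
        fun p _ _ => mul_nonneg (h0 _) (sq_nonneg _))
  have hlow : 2 * ∑ a, ∑ i, ∑ j, Complex.normSq (B a i j) - Fintype.card ι ≤
      ∑ k, (inner ℂ (w k) (toEuclideanLin (B (e k).1.1) (w k))).re := by
    have hF : ∑ a, ∑ i, ∑ j, Complex.normSq (B a i j) = ∑ p, β p ^ 2 := by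
      rw [Fintype.sum_prod_type]
      exact Finset.sum_congr rfl fun a _ => sum_normSq_eq_sum_eigenvalues_sq (hH a)
    have hyk : ∑ k, ‖(Real.sqrt (β (e k)) : ℂ) • v (e k)‖ ^ 2 = ∑ p ∈ T, β p := by
      rw [← hsumT]
      refine Finset.sum_congr rfl fun k _ => ?_
      simp [norm_smul, hv, Real.sq_sqrt (h0 _)]
    have hk : ∀ k, 2 * (inner ℂ ((Real.sqrt (β (e k)) : ℂ) • v (e k)) (w k)).re - 1 ≤
        (inner ℂ (w k) (toEuclideanLin (B (e k).1.1) (w k))).re := fun k => by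
      refine le_trans ?_ (hle (e k) (w k))
      rw [← hyn]
      set z := inner ℂ ((Real.sqrt (β (e k)) : ℂ) • v (e k)) (w k)
      nlinarith [Complex.re_le_norm z, sq_nonneg (‖z‖ - 1)]
    have hk' := Finset.sum_le_sum fun k (_ : k ∈ Finset.univ) => hk k
    rw [Finset.sum_sub_distrib, ← Finset.mul_sum] at hk'
    simp only [Finset.sum_const, Finset.card_univ, nsmul_eq_mul, mul_one] at hk'
    rw [hF]
    linarith
  set U : Matrix ι ι ℂ := Matrix.of fun i k => w k i with hU
  have hUU : Uᴴ * U = 1 := by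
    ext k l
    have := orthonormal_iff_ite.1 w.orthonormal k l
    rw [Matrix.one_apply, ← this]
    simp [Matrix.mul_apply, hU, PiLp.inner_apply, mul_comm]
  have hUU' : U * Uᴴ = 1 := mul_eq_one_comm.1 hUU
  set D : 𝒜 → Matrix ι ι ℂ := fun a => diagonal fun k => if (e k).1.1 = a then 1 else 0 with hD
  have hDD : ∀ a, D a * D a = D a := fun a => by simp [hD, diagonal_mul_diagonal]
  have hDH : ∀ a, (D a)ᴴ = D a := fun a => by
    simp only [hD, diagonal_conjTranspose]
    congr 1; ext k; by_cases h : (e k).1.1 = a <;> simp [h]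
  have hDs : ∑ a, D a = 1 := by
    ext k l
    by_cases hkl : k = l
    · subst hkl; simp [hD, Matrix.sum_apply]
    · simp [hD, Matrix.sum_apply, hkl]
  have hQQ : ∀ a, U * D a * Uᴴ * (U * D a * Uᴴ) = U * D a * Uᴴ := fun a => by
    calc U * D a * Uᴴ * (U * D a * Uᴴ) = U * D a * (Uᴴ * U) * D a * Uᴴ := by
          simp only [Matrix.mul_assoc]
      _ = U * D a * Uᴴ := by rw [hUU, Matrix.mul_one, Matrix.mul_assoc U, hDD]
  have hQH : ∀ a, (U * D a * Uᴴ)ᴴ = U * D a * Uᴴ := fun a => by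
    simp [conjTranspose_mul, hDH, Matrix.mul_assoc]
  have hQs : ∑ a, U * D a * Uᴴ = 1 := by
    rw [← Finset.sum_mul, ← Finset.mul_sum, hDs, Matrix.mul_one, hUU']
  refine ⟨fun a => U * D a * Uᴴ, ⟨fun a => ⟨hQH a, hQQ a⟩, hQs⟩, ?_⟩
  have hterm : ∀ a, ∑ i, ∑ j, Complex.normSq ((B a - U * D a * Uᴴ) i j) =
      ∑ i, ∑ j, Complex.normSq (B a i j) + (U * D a * Uᴴ).trace.re -
        2 * (B a * (U * D a * Uᴴ)).trace.re := fun a => by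
    rw [sum_normSq_eq_trace, sum_normSq_eq_trace, conjTranspose_sub, hQH, (hH a).eq,
      Matrix.sub_mul, Matrix.mul_sub, Matrix.mul_sub, hQQ,
      trace_sub, trace_sub, trace_sub, Matrix.trace_mul_comm (U * D a * Uᴴ) (B a)]
    simp only [Complex.sub_re]
    ring
  have htr : ∀ a, (B a * (U * D a * Uᴴ)).trace.re =
      ∑ k, if (e k).1.1 = a then (inner ℂ (w k) (toEuclideanLin (B a) (w k))).re else 0 :=
    fun a => by
    have h : (B a * (U * D a * Uᴴ)).trace = (Uᴴ * B a * U * D a).trace := by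
      rw [← Matrix.mul_assoc, Matrix.trace_mul_comm]
      simp only [Matrix.mul_assoc]
    rw [h, Matrix.trace, Complex.re_sum]
    refine Finset.sum_congr rfl fun k _ => ?_
    have hkk : (Uᴴ * B a * U) k k = inner ℂ (w k) (toEuclideanLin (B a) (w k)) := by
      rw [Matrix.mul_assoc]
      simp [Matrix.mul_apply, hU, PiLp.inner_apply, mul_comm, toLpLin_apply, mulVec, dotProduct]
    rw [diag_apply, hD, mul_diagonal, hkk]
    split_ifs <;> simp
  simp only [hterm]
  rw [Finset.sum_sub_distrib, Finset.sum_add_distrib, ← Finset.mul_sum, ← Complex.re_sum,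
    ← trace_sum, hQs]
  have hcross : ∑ a, (B a * (U * D a * Uᴴ)).trace.re =
      ∑ k, (inner ℂ (w k) (toEuclideanLin (B (e k).1.1) (w k))).re := by
    simp only [htr]
    rw [Finset.sum_comm]
    simp
  rw [hcross, trace_one, Complex.natCast_re]
  linarith

theorem IsPOVM.sum_normSq_col_le_one {ι 𝒜 : Type*} [Fintype ι] [DecidableEq ι] [Fintype 𝒜]
    {A : 𝒜 → Matrix ι ι ℂ} (hA : IsPOVM A) (j : ι) :
    ∑ i, ∑ a, Complex.normSq (A a i j) ≤ 1 := by
  have hcol : ∀ a, ∑ i, Complex.normSq (A a i j) ≤ (A a j j).re := fun a => by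
    have h0 := hA.1 a
    have h1 : (1 - A a).PosSemidef := by
      classical
      rw [← hA.2, ← Finset.add_sum_erase _ _ (Finset.mem_univ a), add_sub_cancel_left]
      exact posSemidef_sum _ fun b _ => hA.1 b
    have h2 : (A a - A a * A a).PosSemidef := by
      have h3 := (h1.mul_mul_conjTranspose_same (A a)).add
        (h0.mul_mul_conjTranspose_same (1 - A a))
      rw [h0.1.eq, h1.1.eq] at h3
      convert h3 using 1
      noncomm_ring
    have h4 := (Complex.le_def.1 (h2.diag_nonneg (i := j))).1
    have h5 : ((A a * A a) j j).re = ∑ i, Complex.normSq (A a i j) := by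
      rw [Matrix.mul_apply, Complex.re_sum]
      refine Finset.sum_congr rfl fun i _ => ?_
      rw [← h0.1.apply j i, Complex.star_def, ← Complex.normSq_eq_conj_mul_self,
        Complex.ofReal_re]
    simp only [Matrix.sub_apply, Complex.sub_re, Complex.zero_re, h5] at h4
    linarith
  rw [Finset.sum_comm]
  refine (Finset.sum_le_sum fun a _ => hcol a).trans (le_of_eq ?_)
  rw [← Complex.re_sum, ← Matrix.sum_apply, hA.2]
  simp

theorem ev_canonPsi_kronecker_transpose {ι : Type*} [Fintype ι] [DecidableEq ι] (lam : ι → ℝ)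
    {A : Matrix ι ι ℂ} (hA : A.IsHermitian) :
    ev (canonPsi lam) (A ⊗ₖ Aᵀ) =
      ∑ i, ∑ j, Real.sqrt (lam i) * Real.sqrt (lam j) * Complex.normSq (A i j) := by
  simp only [ev, dotProduct, mulVec, Fintype.sum_prod_type, canonPsi, Pi.star_apply,
    kroneckerMap_apply, transpose_apply]
  simp only [mul_ite, mul_zero, Finset.sum_ite_eq, Finset.mem_univ, if_true, apply_ite star,
    star_zero, ite_mul, zero_mul, Complex.re_sum]
  refine Finset.sum_congr rfl fun i _ => ?_
  rw [Finset.mul_sum, Complex.re_sum]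
  refine Finset.sum_congr rfl fun j _ => ?_
  rw [← hA.apply j i, Complex.star_def, Complex.conj_ofReal,
    Complex.mul_conj, ← Complex.ofReal_mul, ← Complex.ofReal_mul, Complex.ofReal_re]
  ring

theorem nsq_kronecker_one_mulVec {ι : Type*} [Fintype ι] [DecidableEq ι] (X : Matrix ι ι ℂ)
    (S : Finset ι) :
    nsq ((X ⊗ₖ (1 : Matrix ι ι ℂ)).mulVec fun p =>
      ((Real.sqrt S.card)⁻¹ : ℂ) * if p.1 = p.2 ∧ p.2 ∈ S then 1 else 0) =
      (S.card : ℝ)⁻¹ * ∑ i, ∑ j ∈ S, Complex.normSq (X i j) := by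
  have h : ∀ i j, (X ⊗ₖ (1 : Matrix ι ι ℂ)).mulVec (fun p =>
      ((Real.sqrt S.card)⁻¹ : ℂ) * if p.1 = p.2 ∧ p.2 ∈ S then 1 else 0) (i, j) =
      ((Real.sqrt S.card)⁻¹ : ℂ) * if j ∈ S then X i j else 0 := fun i j => by
    simp only [mulVec, dotProduct, Fintype.sum_prod_type, kroneckerMap_apply, Matrix.one_apply]
    simp [ite_and, mul_comm]
  simp only [nsq, Fintype.sum_prod_type, h, Finset.mul_sum]
  refine Finset.sum_congr rfl fun i _ => ?_
  rw [← Finset.sum_filter_add_sum_filter_not Finset.univ (· ∈ S)]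
  rw [Finset.sum_eq_zero (s := Finset.univ.filter fun j => j ∉ S)
    (fun j hj => by simp [(Finset.mem_filter.1 hj).2]), add_zero]
  refine Finset.sum_congr (by simp) fun j hj => ?_
  have hjS : j ∈ S := by simpa using hj
  simp [hjS, Complex.normSq_ofReal]

/-- Weighted Connes-type estimate: the defect of the layers of `lam` is controlled by the
defect of the geometric mean. -/
theorem sum_layer_defect_le {ι : Type*} [Fintype ι] (lam : ι → ℝ) (hlam : ∀ i, 0 ≤ lam i)
    (hlam1 : ∑ i, lam i = 1) (G : ι → ι → ℝ) (hG : ∀ i j, 0 ≤ G i j)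
    (hsym : ∀ i j, G i j = G j i) (hcol : ∀ j, ∑ i, G i j ≤ 1) :
    ∑ i, ∑ j, G i j * (lam j - min (lam i) (lam j)) +
        3 * (1 - ∑ i, ∑ j, G i j * min (lam i) (lam j)) ≤
      11 * (1 - ∑ i, ∑ j, Real.sqrt (lam i) * Real.sqrt (lam j) * G i j) ^ (1 / 2 : ℝ) := by
  rw [← Real.sqrt_eq_rpow]
  set r : ι → ℝ := fun i => Real.sqrt (lam i) with hr
  have hr0 : ∀ i, 0 ≤ r i := fun i => Real.sqrt_nonneg _
  have hrr : ∀ i, r i * r i = lam i := fun i => Real.mul_self_sqrt (hlam i)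
  set K := ∑ i, ∑ j, r i * r j * G i j with hK
  set D := ∑ i, ∑ j, G i j * (|lam i - lam j| / 2) with hD
  set L := ∑ i, ∑ j, G i j * lam j with hL
  have hswap : ∑ i, ∑ j, G i j * lam i = L := by
    rw [hL, Finset.sum_comm]
    exact Finset.sum_congr rfl fun i _ => Finset.sum_congr rfl fun j _ => by rw [hsym]
  have hL1 : L ≤ 1 := by
    rw [hL, Finset.sum_comm, ← hlam1]
    refine Finset.sum_le_sum fun j _ => ?_
    rw [← Finset.sum_mul]
    exact mul_le_of_le_one_left (hlam j) (hcol j)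
  have hmin : ∀ i j, min (lam i) (lam j) = (lam i + lam j) / 2 - |lam i - lam j| / 2 :=
    fun i j => by
      rcases le_total (lam i) (lam j) with h | h
      · rw [min_eq_left h, abs_of_nonpos (by linarith)]; ring
      · rw [min_eq_right h, abs_of_nonneg (by linarith)]; ring
  have hM : ∑ i, ∑ j, G i j * min (lam i) (lam j) = L - D := by
    have h : ∀ i j, G i j * min (lam i) (lam j) =
        (G i j * lam i) / 2 + (G i j * lam j) / 2 - G i j * (|lam i - lam j| / 2) :=
      fun i j => by rw [hmin]; ring
    simp only [h, Finset.sum_sub_distrib, Finset.sum_add_distrib, ← Finset.sum_div]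
    rw [hswap]
    ring
  have hM' : ∑ i, ∑ j, G i j * (lam j - min (lam i) (lam j)) = D := by
    simp only [mul_sub, Finset.sum_sub_distrib]
    rw [hM]; ring
  have hK0 : 0 ≤ K := Finset.sum_nonneg fun i _ => Finset.sum_nonneg fun j _ =>
    mul_nonneg (mul_nonneg (hr0 i) (hr0 j)) (hG i j)
  have hX : ∑ i, ∑ j, G i j * (r i - r j) ^ 2 = 2 * L - 2 * K := by
    have h : ∀ i j, G i j * (r i - r j) ^ 2 =
        G i j * lam i + G i j * lam j - 2 * (r i * r j * G i j) :=
      fun i j => by rw [← hrr, ← hrr]; ring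
    simp only [h, Finset.sum_sub_distrib, Finset.sum_add_distrib, ← Finset.mul_sum]
    rw [hswap]
    ring
  have hY : ∑ i, ∑ j, G i j * (r i + r j) ^ 2 = 2 * L + 2 * K := by
    have h : ∀ i j, G i j * (r i + r j) ^ 2 =
        G i j * lam i + G i j * lam j + 2 * (r i * r j * G i j) :=
      fun i j => by rw [← hrr, ← hrr]; ring
    simp only [h, Finset.sum_add_distrib, ← Finset.mul_sum]
    rw [hswap]
    ring
  have hLK : K ≤ L := by
    have : 0 ≤ ∑ i, ∑ j, G i j * (r i - r j) ^ 2 :=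
      Finset.sum_nonneg fun i _ => Finset.sum_nonneg fun j _ =>
        mul_nonneg (hG i j) (sq_nonneg _)
    linarith
  have hKD : L - K ≤ D := by
    have h : ∀ i j, G i j * min (lam i) (lam j) ≤ r i * r j * G i j := fun i j => by
      rw [mul_comm]
      refine mul_le_mul_of_nonneg_right ?_ (hG i j)
      rcases le_total (r i) (r j) with h | h
      · refine (min_le_left _ _).trans ?_
        rw [← hrr]
        exact mul_le_mul_of_nonneg_left h (hr0 i)
      · refine (min_le_right _ _).trans ?_
        rw [← hrr]
        exact mul_le_mul_of_nonneg_right h (hr0 j)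
    have := Finset.sum_le_sum fun i (_ : i ∈ Finset.univ) =>
      Finset.sum_le_sum fun j (_ : j ∈ Finset.univ) => h i j
    linarith
  have hCS : (2 * D) ^ 2 ≤ (2 * L - 2 * K) * (2 * L + 2 * K) := by
    rw [← hX, ← hY, hD, ← Fintype.sum_prod_type', ← Fintype.sum_prod_type',
      ← Fintype.sum_prod_type', Finset.mul_sum]
    refine Finset.sum_sq_le_sum_mul_sum_of_sq_le_mul _
      (fun p _ => mul_nonneg (hG _ _) (sq_nonneg _))
      (fun p _ => mul_nonneg (hG _ _) (sq_nonneg _)) fun p _ => ?_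
    have : |lam p.1 - lam p.2| ^ 2 = ((r p.1 - r p.2) * (r p.1 + r p.2)) ^ 2 := by
      rw [sq_abs, ← hrr, ← hrr]; ring
    calc (2 * (G p.1 p.2 * (|lam p.1 - lam p.2| / 2))) ^ 2 =
        G p.1 p.2 ^ 2 * |lam p.1 - lam p.2| ^ 2 := by ring
      _ ≤ _ := by rw [this]; exact le_of_eq (by ring)
  have hD2 : D ^ 2 ≤ 2 * (1 - K) := by nlinarith
  set t := Real.sqrt (1 - K) with ht
  have htt : t * t = 1 - K := Real.mul_self_sqrt (by linarith)
  have ht0 : 0 ≤ t := Real.sqrt_nonneg _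
  have ht1 : t ≤ 1 := by nlinarith
  have hDt : D ≤ 2 * t := abs_le_of_sq_le_sq' (by nlinarith) (by linarith) |>.2
  rw [hM, hM']
  nlinarith

/-- The inclusion of the coordinate subspace indexed by `S`. -/
def coordIncl {ι : Type*} [DecidableEq ι] (S : Finset ι) : Matrix ι S ℂ :=
  (1 : Matrix ι ι ℂ).submatrix id (↑)

theorem conjTranspose_coordIncl_mul {ι : Type*} [Fintype ι] [DecidableEq ι] (S : Finset ι)
    (X : Matrix ι ι ℂ) : (coordIncl S)ᴴ * X * coordIncl S = X.submatrix (↑) (↑) := by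
  ext i j
  simp [coordIncl, Matrix.mul_apply, Matrix.one_apply]

theorem coordIncl_mul_conjTranspose {ι : Type*} [Fintype ι] [DecidableEq ι] (S : Finset ι) :
    coordIncl S * (coordIncl S)ᴴ = diagonal fun i => if i ∈ S then 1 else 0 := by
  ext i j
  rw [Matrix.mul_apply, Matrix.diagonal_apply]
  simp only [coordIncl, submatrix_apply, conjTranspose_apply, id, Matrix.one_apply]
  rw [Finset.sum_coe_sort S fun k =>
    (if i = k then (1 : ℂ) else 0) * star (if j = k then 1 else 0)]
  by_cases h : i = j
  · subst h; simp
  · simp [h, apply_ite star]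

theorem conjTranspose_coordIncl_mul_self {ι : Type*} [Fintype ι] [DecidableEq ι]
    (S : Finset ι) : (coordIncl S)ᴴ * coordIncl S = 1 := by
  rw [← Matrix.mul_one (coordIncl S)ᴴ, conjTranspose_coordIncl_mul,
    submatrix_one _ Subtype.val_injective]

theorem isMaxEntOn_coord {ι : Type*} [Fintype ι] [DecidableEq ι] (S : Finset ι) :
    IsMaxEntOn (fun p : ι × ι =>
      ((Real.sqrt S.card)⁻¹ : ℂ) * if p.1 = p.2 ∧ p.2 ∈ S then 1 else 0)
      (diagonal fun i => if i ∈ S then 1 else 0) := by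
  refine ⟨S, fun i => Pi.single i 1, fun i _ j _ => ?_, ?_, ?_⟩
  · simp only [dotProduct_single, Pi.star_apply, Pi.single_apply]
    by_cases h : i = j
    · simp [h]
    · simp [h, Ne.symm h]
  · ext i j
    rw [Matrix.diagonal_apply, Matrix.sum_apply]
    simp only [vecMulVec_apply, Pi.star_apply, Pi.single_apply]
    by_cases h : i = j
    · subst h; simp [apply_ite star]
    · simp [h, apply_ite star]
  · funext p
    congr 1
    simp only [Pi.single_apply]
    by_cases h : p.1 = p.2
    · simp [h]
    · simp [h]

/-- Compressing a POVM to a coordinate subspace and rounding there. -/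
theorem exists_isProjMeasOn_coord {ι 𝒜 : Type*} [Fintype ι] [DecidableEq ι] [Fintype 𝒜]
    {A : 𝒜 → Matrix ι ι ℂ} (hA : IsPOVM A) (S : Finset ι) :
    ∃ Q : 𝒜 → Matrix ι ι ℂ,
      IsProjMeasOn (diagonal fun i => if i ∈ S then 1 else 0) Q ∧
      ∑ a, ∑ i, ∑ j ∈ S, Complex.normSq ((A a - Q a) i j) ≤
        ∑ i ∈ Sᶜ, ∑ j ∈ S, ∑ a, Complex.normSq (A a i j) +
          3 * (S.card - ∑ i ∈ S, ∑ j ∈ S, ∑ a, Complex.normSq (A a i j)) := by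
  set E := coordIncl S with hE
  have hEE : Eᴴ * E = 1 := conjTranspose_coordIncl_mul_self S
  have hB : IsPOVM fun a => (A a).submatrix ((↑) : S → ι) (↑) := by
    refine ⟨fun a => (hA.1 a).submatrix _, ?_⟩
    ext i j
    have := congrFun (congrFun hA.2 i) j
    rw [Matrix.sum_apply] at this ⊢
    simpa [Matrix.one_apply] using this
  obtain ⟨Q, ⟨hQ, hQs⟩, hle⟩ := exists_isProjMeas_near _ hB
  rw [← coordIncl_mul_conjTranspose, ← hE]
  refine ⟨fun a => E * Q a * Eᴴ, ⟨fun a => ⟨?_, ?_, ?_, ?_⟩, ?_⟩, ?_⟩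
  · simp [conjTranspose_mul, (hQ a).1, Matrix.mul_assoc]
  · calc E * Q a * Eᴴ * (E * Q a * Eᴴ) = E * Q a * (Eᴴ * E) * Q a * Eᴴ := by
          simp only [Matrix.mul_assoc]
      _ = E * Q a * Eᴴ := by rw [hEE, Matrix.mul_one, Matrix.mul_assoc E, (hQ a).2]
  · calc E * Eᴴ * (E * Q a * Eᴴ) = E * (Eᴴ * E) * Q a * Eᴴ := by
          simp only [Matrix.mul_assoc]
      _ = E * Q a * Eᴴ := by rw [hEE, Matrix.mul_one]
  · calc E * Q a * Eᴴ * (E * Eᴴ) = E * Q a * (Eᴴ * E) * Eᴴ := by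
          simp only [Matrix.mul_assoc]
      _ = E * Q a * Eᴴ := by rw [hEE, Matrix.mul_one]
  · rw [← Matrix.sum_mul, ← Matrix.mul_sum, hQs, Matrix.mul_one]
  · have hin : ∀ a (i j : S), (E * Q a * Eᴴ) i j = Q a i j := fun a i j => by
      have h : Eᴴ * (E * Q a * Eᴴ) * E = Q a := by
        calc Eᴴ * (E * Q a * Eᴴ) * E = (Eᴴ * E) * Q a * (Eᴴ * E) := by
              simp only [Matrix.mul_assoc]
          _ = Q a := by rw [hEE, Matrix.mul_one, Matrix.one_mul]
      rw [conjTranspose_coordIncl_mul] at h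
      exact congrFun (congrFun h i) j
    have hout : ∀ a, ∀ i ∉ S, ∀ j, (E * Q a * Eᴴ) i j = 0 := fun a i hi j => by
      rw [Matrix.mul_assoc, Matrix.mul_apply]
      refine Finset.sum_eq_zero fun k _ => ?_
      have : E i k = 0 := by
        rw [hE, coordIncl, submatrix_apply, id, Matrix.one_apply_ne]
        rintro rfl
        exact hi k.2
      rw [this, zero_mul]
    have hsplit : ∀ a, ∑ i, ∑ j ∈ S, Complex.normSq ((A a - E * Q a * Eᴴ) i j) =
        ∑ i ∈ Sᶜ, ∑ j ∈ S, Complex.normSq (A a i j) +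
        ∑ i : S, ∑ j : S,
          Complex.normSq (((A a).submatrix ((↑) : S → ι) ((↑) : S → ι) - Q a) i j) := fun a => by
      rw [← Finset.sum_add_sum_compl S, add_comm]
      congr 1
      · refine Finset.sum_congr rfl fun i hi => Finset.sum_congr rfl fun j _ => ?_
        rw [Matrix.sub_apply, hout a i (Finset.mem_compl.1 hi), sub_zero]
      · rw [← Finset.sum_coe_sort S]
        refine Finset.sum_congr rfl fun i _ => ?_
        rw [← Finset.sum_coe_sort S]
        refine Finset.sum_congr rfl fun j _ => ?_
        rw [Matrix.sub_apply, hin, Matrix.sub_apply, submatrix_apply]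
    have hcomm : ∀ T : Finset ι, ∑ i ∈ T, ∑ j ∈ S, ∑ a, Complex.normSq (A a i j) =
        ∑ a, ∑ i ∈ T, ∑ j ∈ S, Complex.normSq (A a i j) := fun T => by
      rw [Finset.sum_comm (s := Finset.univ)]
      exact Finset.sum_congr rfl fun i _ => Finset.sum_comm
    have hSS : ∑ a, ∑ i : S, ∑ j : S, Complex.normSq ((A a).submatrix (↑) (↑) i j) =
        ∑ a, ∑ i ∈ S, ∑ j ∈ S, Complex.normSq (A a i j) := by
      refine Finset.sum_congr rfl fun a _ => ?_
      rw [← Finset.sum_coe_sort S]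
      refine Finset.sum_congr rfl fun i _ => ?_
      rw [← Finset.sum_coe_sort S]
      rfl
    rw [hSS, Fintype.card_coe] at hle
    simp only [hsplit]
    rw [hcomm, hcomm, Finset.sum_add_distrib]
    linarith

/-- the introduction version of the main theorem: for any state
`|ψ⟩ = Σ_i √λ_i |i⟩|i⟩` there are a finite set `Λ`, a distribution `μ` and maximally
entangled states `|ψ_λ⟩` on subspaces `H_λ ⊆ H` (depending only on `|ψ⟩`) with
`ρ = E_λ ρ_λ`, such that every POVM is approximated by projective measurements on the
`H_λ` with error controlled by the inconsistency of the POVM. -/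
theorem stmt9 :
    ∃ c C : ℝ, 0 < c ∧ 0 < C ∧
    ∀ (n : ℕ) (lam : Fin n → ℝ) (_hlam : ∀ i, 0 ≤ lam i) (_hlam1 : ∑ i, lam i = 1),
      ∃ (N : ℕ) (μ : Fin N → ℝ) (_hμ : IsDist μ)
        (P : Fin N → Matrix (Fin n) (Fin n) ℂ) (ψl : Fin N → (Fin n × Fin n → ℂ)),
        (∀ l, IsMaxEntOn (ψl l) (P l)) ∧
        (Matrix.diagonal (fun i => (lam i : ℂ)) =
          ∑ l, μ l • (((P l).trace)⁻¹ • P l)) ∧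
        ∀ (𝒜 : Type) [Fintype 𝒜] (A : 𝒜 → Matrix (Fin n) (Fin n) ℂ), IsPOVM A →
          ∃ Al : Fin N → 𝒜 → Matrix (Fin n) (Fin n) ℂ,
            (∀ l, IsProjMeasOn (P l) (Al l)) ∧
            ∑ l, μ l * ∑ a,
                nsq (((A a - Al l a) ⊗ₖ (1 : Matrix (Fin n) (Fin n) ℂ)).mulVec (ψl l))
              ≤ C * (1 - ∑ a, ev (canonPsi lam) (A a ⊗ₖ (A a)ᵀ)) ^ c := by
  refine ⟨1 / 2, 11, by norm_num, by norm_num, fun n lam hlam hlam1 => ?_⟩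
  obtain ⟨N, w, S, hw, hS⟩ := exists_nested_supports lam hlam
  have hS1 : ∀ i, ∑ l, (if i ∈ S l then w l else 0) = lam i := fun i => by
    simpa using hS i i
  have hcard : ∑ l, w l * (S l).card = 1 := by
    rw [← hlam1]
    simp only [← hS1]
    rw [Finset.sum_comm]
    refine Finset.sum_congr rfl fun l _ => ?_
    simp [mul_comm]
  refine ⟨N, fun l => w l * (S l).card,
    ⟨fun l => mul_nonneg (hw l) (Nat.cast_nonneg _), hcard⟩,
    fun l => diagonal fun i => if i ∈ S l then 1 else 0,
    fun l p => ((Real.sqrt (S l).card)⁻¹ : ℂ) * if p.1 = p.2 ∧ p.2 ∈ S l then 1 else 0,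
    fun l => isMaxEntOn_coord (S l), ?_, fun 𝒜 _ A hA => ?_⟩
  · ext i j
    rw [Matrix.sum_apply]
    by_cases hij : i = j
    · subst hij
      simp only [diagonal_apply_eq, Matrix.smul_apply, trace_diagonal]
      rw [← hS1 i, Complex.ofReal_sum]
      refine Finset.sum_congr rfl fun l _ => ?_
      by_cases hi : i ∈ S l
      · have : ((S l).card : ℂ) ≠ 0 := by exact_mod_cast Finset.card_ne_zero_of_mem hi
        simp [hi, this]
      · simp [hi]
    · simp [hij]
  · choose Al hAl hle using fun l => exists_isProjMeasOn_coord hA (S l)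
    refine ⟨Al, hAl, ?_⟩
    set G : Fin n → Fin n → ℝ := fun i j => ∑ a, Complex.normSq (A a i j) with hG
    have hH : ∀ a, (A a).IsHermitian := fun a => (hA.1 a).1
    have hdef := sum_layer_defect_le lam hlam hlam1 G
      (fun i j => Finset.sum_nonneg fun a _ => Complex.normSq_nonneg _)
      (fun i j => Finset.sum_congr rfl fun a _ => by
        rw [← (hH a).apply i j, Complex.star_def, Complex.normSq_conj])
      (fun j => hA.sum_normSq_col_le_one j)
    have hev : ∑ a, ev (canonPsi lam) (A a ⊗ₖ (A a)ᵀ) =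
        ∑ i, ∑ j, Real.sqrt (lam i) * Real.sqrt (lam j) * G i j := by
      simp only [ev_canonPsi_kronecker_transpose lam (hH _), hG, Finset.mul_sum]
      rw [Finset.sum_comm]
      exact Finset.sum_congr rfl fun i _ => Finset.sum_comm
    rw [hev]
    refine le_trans ?_ hdef
    have hlayer : ∀ l, (w l * (S l).card) * ∑ a,
        nsq (((A a - Al l a) ⊗ₖ (1 : Matrix (Fin n) (Fin n) ℂ)).mulVec fun p =>
          ((Real.sqrt (S l).card)⁻¹ : ℂ) * if p.1 = p.2 ∧ p.2 ∈ S l then 1 else 0) ≤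
        w l * (∑ i ∈ (S l)ᶜ, ∑ j ∈ S l, G i j +
          3 * ((S l).card - ∑ i ∈ S l, ∑ j ∈ S l, G i j)) := fun l => by
      simp only [nsq_kronecker_one_mulVec]
      rw [← Finset.mul_sum, mul_assoc]
      refine mul_le_mul_of_nonneg_left ?_ (hw l)
      rcases (S l).eq_empty_or_nonempty with h | h
      · simp [h]
      · have : ((S l).card : ℝ) ≠ 0 := by exact_mod_cast h.card_pos.ne'
        rw [mul_inv_cancel_left₀ this]
        exact hle l
    refine (Finset.sum_le_sum fun l _ => hlayer l).trans (le_of_eq ?_)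
    have hSS : ∑ l, w l * ∑ i ∈ S l, ∑ j ∈ S l, G i j =
        ∑ i, ∑ j, G i j * min (lam i) (lam j) := by
      have h : ∀ l, w l * ∑ i ∈ S l, ∑ j ∈ S l, G i j =
          ∑ i, ∑ j, G i j * if i ∈ S l ∧ j ∈ S l then w l else 0 := fun l => by
        simp [ite_and, Finset.mul_sum, mul_comm]
      simp only [h, ← hS, Finset.mul_sum]
      rw [Finset.sum_comm]
      exact Finset.sum_congr rfl fun i _ => Finset.sum_comm
    have hall : ∑ l, w l * ∑ i, ∑ j ∈ S l, G i j = ∑ i, ∑ j, G i j * lam j := by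
      have h : ∀ l, w l * ∑ i, ∑ j ∈ S l, G i j =
          ∑ i, ∑ j, G i j * if j ∈ S l then w l else 0 := fun l => by
        simp [Finset.mul_sum, mul_comm]
      simp only [h, ← hS1, Finset.mul_sum]
      rw [Finset.sum_comm]
      exact Finset.sum_congr rfl fun i _ => Finset.sum_comm
    have hcompl : ∀ l, ∑ i ∈ (S l)ᶜ, ∑ j ∈ S l, G i j =
        ∑ i, ∑ j ∈ S l, G i j - ∑ i ∈ S l, ∑ j ∈ S l, G i j := fun l => by
      rw [← Finset.sum_add_sum_compl (S l)]; ring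
    simp only [hcompl, mul_sub, Finset.sum_sub_distrib, ← hall, ← hSS, mul_add,
      Finset.sum_add_distrib, mul_left_comm _ (3 : ℝ), ← Finset.mul_sum, hcard]

end AlmostSync
end

section
/- There are universal constants c, C > 0 such that the following holds. Let 𝒮 = (|ψ⟩, A, B) be a strategy with 𝒴 = 𝒳 and ℬ = 𝒜, ν a distribution on 𝒳, and δ = δ_sync(𝒮; ν). Let ρ_A be the reduced density of |ψ⟩ on H_A, for λ ∈ ℝ_+ let P_λ be the spectral projection of ρ_A onto eigenvalues ≥ λ, H_λ = range(P_λ), ρ_λ = P_λ / Tr(P_λ), and dμ(λ) = Tr(P_λ) dλ. Then ρ_A = ∫_0^∞ P_λ dλ, and for every λ and x ∈ 𝒳 there is a projective measurement {A^{λ,x}_a}_{a∈𝒜} supported on H_λ such that E_{x∼ν} Σ_a ∫_0^∞ Tr((A^x_a − A^{λ,x}_a)² ρ_λ) dμ(λ) ≤ C δ^c. (The analogous statement holds for the measurements B on H_B with ρ_B in place of ρ_A.) -/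
open scoped Kronecker ComplexOrder
open Matrix MeasureTheory

attribute [local instance] Matrix.normedAddCommGroup Matrix.normedSpace

namespace AlmostSync

section Matrices

variable {n 𝒜 : Type*} [Fintype n] [DecidableEq n] [Fintype 𝒜]

lemma posSemidef_sub_mul_self {A : Matrix n n ℂ} (hA : A.PosSemidef) (hA' : (1 - A).PosSemidef) :
    (A - A * A).PosSemidef := by
  have h₁ := hA'.conjTranspose_mul_mul_same A
  have h₂ := hA.conjTranspose_mul_mul_same (1 - A)
  rw [hA.isHermitian.eq] at h₁
  rw [hA'.isHermitian.eq] at h₂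
  have h := h₁.add h₂
  have e : A * (1 - A) * A + (1 - A) * A * (1 - A) = A - A * A := by noncomm_ring
  rwa [e] at h

lemma IsPOVM.one_sub_posSemidef {A : 𝒜 → Matrix n n ℂ} (hA : IsPOVM A) (a : 𝒜) :
    (1 - A a).PosSemidef := by
  classical
  have h : 1 - A a = ∑ b ∈ Finset.univ.erase a, A b := by
    rw [← hA.2, ← Finset.add_sum_erase _ _ (Finset.mem_univ a), add_sub_cancel_left]
  rw [h]
  exact posSemidef_sum _ fun b _ => hA.1 b

lemma isHermitian_eq_conj_diagonal {M : Matrix n n ℂ} (hM : M.IsHermitian) :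
    M = (hM.eigenvectorUnitary : Matrix n n ℂ) * diagonal (fun i => (hM.eigenvalues i : ℂ)) *
      (hM.eigenvectorUnitary : Matrix n n ℂ)ᴴ := by
  conv_lhs => rw [hM.spectral_theorem]
  rfl

lemma eigenvectorUnitary_conjTranspose_mul {M : Matrix n n ℂ} (hM : M.IsHermitian) :
    (hM.eigenvectorUnitary : Matrix n n ℂ)ᴴ * (hM.eigenvectorUnitary : Matrix n n ℂ) = 1 :=
  mem_unitaryGroup_iff'.mp hM.eigenvectorUnitary.2

lemma eigenvectorUnitary_mul_conjTranspose {M : Matrix n n ℂ} (hM : M.IsHermitian) :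
    (hM.eigenvectorUnitary : Matrix n n ℂ) * (hM.eigenvectorUnitary : Matrix n n ℂ)ᴴ = 1 :=
  mem_unitaryGroup_iff.mp hM.eigenvectorUnitary.2

/-- A square matrix with orthogonal columns is a unitary times a diagonal matrix. -/
lemma exists_unitary_mul_diagonal {Z : Matrix n n ℂ} {g : n → ℝ}
    (hZ : Zᴴ * Z = diagonal (fun i => (g i : ℂ))) :
    ∃ b : Matrix n n ℂ, bᴴ * b = 1 ∧ b * bᴴ = 1 ∧
      Z = b * diagonal (fun i => (Real.sqrt (g i) : ℂ)) := by
  have hcol : ∀ i j, ∑ k, star (Z k i) * Z k j = if i = j then (g i : ℂ) else 0 := by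
    intro i j
    have := congrFun (congrFun hZ i) j
    simpa [Matrix.mul_apply, diagonal_apply] using this
  have hg : ∀ j, g j = ∑ k, Complex.normSq (Z k j) := by
    intro j
    have := hcol j j
    simp only [if_true] at this
    apply_fun Complex.re at this
    simp only [Complex.ofReal_re] at this
    rw [← this, Complex.re_sum]
    refine Finset.sum_congr rfl fun k _ => ?_
    rw [Complex.star_def, ← Complex.normSq_eq_conj_mul_self, Complex.ofReal_re]
  have hg0 : ∀ j, 0 ≤ g j := fun j => by
    rw [hg]; exact Finset.sum_nonneg fun k _ => Complex.normSq_nonneg _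
  let v : n → EuclideanSpace ℂ n := fun j => WithLp.toLp 2 fun i => Z i j / (Real.sqrt (g j) : ℂ)
  let s : Set n := {j | g j ≠ 0}
  have hv : Orthonormal ℂ (s.domRestrict v) := by
    rw [orthonormal_iff_ite]
    rintro ⟨i, hi⟩ ⟨j, hj⟩
    have hi' : (Real.sqrt (g i) : ℂ) ≠ 0 := by
      rw [Complex.ofReal_ne_zero, Real.sqrt_ne_zero (hg0 i)]; exact hi
    have hii : (Real.sqrt (g i) : ℂ) * (Real.sqrt (g i) : ℂ) = g i := by
      rw [← Complex.ofReal_mul, Real.mul_self_sqrt (hg0 i)]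
    have : inner ℂ (v i) (v j) =
        (∑ k, star (Z k i) * Z k j) / ((Real.sqrt (g i) : ℂ) * (Real.sqrt (g j) : ℂ)) := by
      simp only [v, PiLp.inner_apply, RCLike.inner_apply, Finset.sum_div]
      refine Finset.sum_congr rfl fun k _ => ?_
      simp only [map_div₀, Complex.conj_ofReal, Complex.star_def]
      ring
    change inner ℂ (v i) (v j) = _
    rw [this, hcol]
    simp only [Subtype.mk.injEq]
    split_ifs with h
    · subst h
      rw [hii, div_self]
      exact Complex.ofReal_ne_zero.mpr hi
    · simp
  obtain ⟨b, hb⟩ := hv.exists_orthonormalBasis_extension_of_card_eq (by simp)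
  let U := (EuclideanSpace.basisFun n ℂ).toBasis.toMatrix b.toBasis
  have hU : U ∈ unitaryGroup n ℂ :=
    (EuclideanSpace.basisFun n ℂ).toMatrix_orthonormalBasis_mem_unitary b
  refine ⟨U, mem_unitaryGroup_iff'.mp hU, mem_unitaryGroup_iff.mp hU, ?_⟩
  ext i j
  rw [mul_diagonal]
  have hUij : U i j = b j i := by simp [U, Module.Basis.toMatrix_apply]
  rw [hUij]
  by_cases h : g j = 0
  · have h0 : ∑ k, Complex.normSq (Z k j) = 0 := by rw [← hg, h]
    rw [Finset.sum_eq_zero_iff_of_nonneg fun k _ => Complex.normSq_nonneg _] at h0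
    have := Complex.normSq_eq_zero.mp (h0 i (Finset.mem_univ i))
    simp [this, h]
  · rw [hb j h]
    have hj' : (Real.sqrt (g j) : ℂ) ≠ 0 := by
      rw [Complex.ofReal_ne_zero, Real.sqrt_ne_zero (hg0 j)]; exact h
    simp only [v]
    rw [div_mul_cancel₀ _ hj']

/-- A contraction is close to a unitary in terms of the trace of its defect. -/
lemma exists_unitary_close (W : Matrix n n ℂ) (hW : (1 - W * Wᴴ).PosSemidef) :
    ∃ U : Matrix n n ℂ, Uᴴ * U = 1 ∧ U * Uᴴ = 1 ∧
      ((U - W)ᴴ * (U - W)).trace.re ≤ (1 - W * Wᴴ).trace.re := by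
  have hG : (W * Wᴴ).IsHermitian := isHermitian_mul_conjTranspose_self W
  set V := (hG.eigenvectorUnitary : Matrix n n ℂ) with hV
  set g := hG.eigenvalues with hgdef
  have hVV : Vᴴ * V = 1 := eigenvectorUnitary_conjTranspose_mul hG
  have hVV' : V * Vᴴ = 1 := eigenvectorUnitary_mul_conjTranspose hG
  have hD : W * Wᴴ = V * diagonal (fun i => (g i : ℂ)) * Vᴴ := isHermitian_eq_conj_diagonal hG
  have hDV : Vᴴ * (W * Wᴴ) * V = diagonal (fun i => (g i : ℂ)) := by
    rw [hD]
    calc Vᴴ * (V * diagonal (fun i => (g i : ℂ)) * Vᴴ) * V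
        = (Vᴴ * V) * diagonal (fun i => (g i : ℂ)) * (Vᴴ * V) := by noncomm_ring
      _ = _ := by rw [hVV, one_mul, mul_one]
  have hg0 : ∀ i, 0 ≤ g i := (posSemidef_self_mul_conjTranspose W).eigenvalues_nonneg
  have hg1 : ∀ i, g i ≤ 1 := by
    intro i
    have h := (hW.conjTranspose_mul_mul_same V).diag_nonneg (i := i)
    have e : Vᴴ * (1 - W * Wᴴ) * V = 1 - diagonal (fun i => (g i : ℂ)) := by
      rw [mul_sub, sub_mul, hDV, mul_one, hVV]
    rw [e] at h
    simp only [Matrix.sub_apply, one_apply_eq, diagonal_apply_eq] at h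
    have := (Complex.le_def.mp h).1
    simp at this
    linarith
  obtain ⟨b, hb, hb', hZ⟩ := exists_unitary_mul_diagonal (Z := Wᴴ * V) (g := g) (by
    rw [← hDV]; simp [Matrix.mul_assoc])
  set S := diagonal (fun i => (Real.sqrt (g i) : ℂ)) with hS
  have hSH : Sᴴ = S := by
    simp [hS, diagonal_conjTranspose, Pi.star_def]
  have hWe : W = V * S * bᴴ := by
    have : Wᴴ = b * S * Vᴴ := by
      rw [← hZ, Matrix.mul_assoc, hVV', mul_one]
    rw [← conjTranspose_conjTranspose W, this]
    simp [hSH, Matrix.mul_assoc]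
  refine ⟨V * bᴴ, ?_, ?_, ?_⟩
  · calc (V * bᴴ)ᴴ * (V * bᴴ) = b * (Vᴴ * V) * bᴴ := by simp [Matrix.mul_assoc]
      _ = 1 := by rw [hVV, mul_one, hb']
  · calc (V * bᴴ) * (V * bᴴ)ᴴ = V * (bᴴ * b) * Vᴴ := by simp [Matrix.mul_assoc]
      _ = 1 := by rw [hb, mul_one, hVV']
  · have e₁ : V * bᴴ - W = V * (1 - S) * bᴴ := by rw [hWe]; noncomm_ring
    have e₂ : ((V * bᴴ - W)ᴴ * (V * bᴴ - W)).trace = ((1 - S) * (1 - S)).trace := by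
      rw [e₁]
      calc ((V * (1 - S) * bᴴ)ᴴ * (V * (1 - S) * bᴴ)).trace
          = (b * ((1 - S) * (Vᴴ * V) * (1 - S) * bᴴ)).trace := by
            simp [Matrix.mul_assoc, hSH]
        _ = _ := by rw [trace_mul_comm, hVV, mul_one, Matrix.mul_assoc, hb, mul_one]
    have e₃ : (1 - W * Wᴴ).trace = (1 - diagonal (fun i => (g i : ℂ))).trace := by
      rw [← hDV, trace_sub, trace_sub, Matrix.mul_assoc, trace_mul_comm Vᴴ, Matrix.mul_assoc,
        hVV', mul_one]
    rw [e₂, e₃]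
    simp only [trace, diag_apply, Complex.re_sum]
    refine Finset.sum_le_sum fun i _ => ?_
    have : (1 - S) * (1 - S) = diagonal (fun i => ((1 - Real.sqrt (g i) : ℝ) : ℂ) ^ 2) := by
      rw [hS, ← diagonal_one, diagonal_sub, diagonal_mul_diagonal]
      congr 1; ext i; push_cast; ring
    rw [this, Matrix.sub_apply, one_apply_eq, diagonal_apply_eq, diagonal_apply_eq,
      ← Complex.ofReal_pow, Complex.ofReal_re, Complex.sub_re, Complex.one_re, Complex.ofReal_re]
    have h₁ := Real.sqrt_nonneg (g i)
    have h₂ := Real.sq_sqrt (hg0 i)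
    have h₃ : Real.sqrt (g i) ≤ 1 := Real.sqrt_le_one.mpr (hg1 i)
    nlinarith

lemma exists_top_finset {I : Type*} [Fintype I] (f : I → ℝ) {d : ℕ} (hd : d ≤ Fintype.card I) :
    ∃ S : Finset I, S.card = d ∧ ∀ s ∈ S, ∀ r ∉ S, f r ≤ f s := by
  classical
  induction d with
  | zero => exact ⟨∅, by simp, by simp⟩
  | succ d ih =>
    obtain ⟨S, hS, hf⟩ := ih (by omega)
    have hne : Sᶜ.Nonempty := by
      rw [← Finset.card_pos, Finset.card_compl]; omega
    obtain ⟨m, hm, hmax⟩ := Finset.exists_max_image Sᶜ f hne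
    rw [Finset.mem_compl] at hm
    refine ⟨insert m S, by rw [Finset.card_insert_of_notMem hm, hS], ?_⟩
    intro s hs r hr
    rw [Finset.mem_insert, not_or] at hr
    rcases Finset.mem_insert.mp hs with rfl | hs
    · exact hmax r (Finset.mem_compl.mpr hr.2)
    · exact hf s hs r hr.2

/-- If `[0,1]`-valued weights sum to `|S|`, where `S` carries the largest weights, then the defect
of `S` is bounded by the total variance. -/
lemma sum_one_sub_le_of_top {I : Type*} [Fintype I] {f : I → ℝ} {S : Finset I}
    (h₀ : ∀ i, 0 ≤ f i) (h₁ : ∀ i, f i ≤ 1) (hf : ∀ s ∈ S, ∀ r ∉ S, f r ≤ f s)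
    (hsum : ∑ i, f i = S.card) :
    ∑ s ∈ S, (1 - f s) ≤ ∑ i, f i * (1 - f i) := by
  classical
  rcases S.eq_empty_or_nonempty with rfl | hne
  · rw [Finset.sum_empty]
    exact Finset.sum_nonneg fun i _ => mul_nonneg (h₀ i) (sub_nonneg.mpr (h₁ i))
  obtain ⟨m, hm, hmin⟩ := Finset.exists_min_image S f hne
  have hsplit : ∀ g : I → ℝ, ∑ i, g i = ∑ s ∈ S, g s + ∑ r ∈ Sᶜ, g r := fun g =>
    (Finset.sum_add_sum_compl S g).symm
  have e : ∑ s ∈ S, (1 - f s) = ∑ r ∈ Sᶜ, f r := by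
    rw [Finset.sum_sub_distrib, Finset.sum_const, nsmul_eq_mul, mul_one, ← hsum, hsplit]
    ring
  have i₁ : f m * ∑ s ∈ S, (1 - f s) ≤ ∑ s ∈ S, f s * (1 - f s) := by
    rw [Finset.mul_sum]
    exact Finset.sum_le_sum fun s hs =>
      mul_le_mul_of_nonneg_right (hmin s hs) (sub_nonneg.mpr (h₁ s))
  have i₂ : (1 - f m) * ∑ r ∈ Sᶜ, f r ≤ ∑ r ∈ Sᶜ, f r * (1 - f r) := by
    rw [Finset.mul_sum]
    refine Finset.sum_le_sum fun r hr => ?_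
    have := hf m hm r (Finset.mem_compl.mp hr)
    nlinarith [h₀ r]
  rw [hsplit]
  rw [← e] at i₂
  linarith

lemma quadForm_add_le {m : Type*} [Fintype m] {M : Matrix m m ℂ} (hM : M.PosSemidef)
    (x y : m → ℂ) :
    (star (x + y) ⬝ᵥ M *ᵥ (x + y)).re ≤
      2 * (star x ⬝ᵥ M *ᵥ x).re + 2 * (star y ⬝ᵥ M *ᵥ y).re := by
  have h := hM.re_dotProduct_nonneg (x - y)
  have e : (star (x - y) ⬝ᵥ M *ᵥ (x - y)) + (star (x + y) ⬝ᵥ M *ᵥ (x + y)) =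
      2 * (star x ⬝ᵥ M *ᵥ x) + 2 * (star y ⬝ᵥ M *ᵥ y) := by
    simp only [star_sub, star_add, mulVec_sub, mulVec_add, sub_dotProduct, add_dotProduct,
      dotProduct_sub, dotProduct_add]
    ring
  apply_fun Complex.re at e
  simp only [Complex.add_re, Complex.mul_re, Complex.re_ofNat, Complex.im_ofNat, zero_mul,
    sub_zero] at e
  change 0 ≤ (star (x - y) ⬝ᵥ M *ᵥ (x - y)).re at h
  linarith

lemma sum_vecMulVec_eq {M : Matrix n n ℂ} (hM : M.IsHermitian) :
    M = ∑ k, (hM.eigenvalues k : ℂ) •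
      vecMulVec ⇑(hM.eigenvectorBasis k) (star ⇑(hM.eigenvectorBasis k)) := by
  conv_lhs => rw [isHermitian_eq_conj_diagonal hM]
  ext i j
  rw [Matrix.mul_apply]
  simp only [mul_diagonal, conjTranspose_apply, Matrix.sum_apply,
    Matrix.smul_apply, vecMulVec_apply, IsHermitian.eigenvectorUnitary_apply, smul_eq_mul,
    Pi.star_apply]
  exact Finset.sum_congr rfl fun k _ => by ring

lemma trace_mul_self_eq_sum_eigenvalues {M : Matrix n n ℂ} (hM : M.IsHermitian) :
    (M * M).trace = ∑ k, (hM.eigenvalues k : ℂ) ^ 2 := by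
  have hV := eigenvectorUnitary_conjTranspose_mul hM
  have e := isHermitian_eq_conj_diagonal hM
  set V := (hM.eigenvectorUnitary : Matrix n n ℂ)
  set D := diagonal (fun i => (hM.eigenvalues i : ℂ)) with hD
  have : (M * M).trace = (D * D).trace := by
    conv_lhs => rw [e]
    calc (V * D * Vᴴ * (V * D * Vᴴ)).trace = (V * (D * (Vᴴ * V) * D * Vᴴ)).trace := by
          simp only [Matrix.mul_assoc]
      _ = _ := by rw [trace_mul_comm, hV, mul_one, Matrix.mul_assoc, hV, mul_one]
  rw [this, hD, diagonal_mul_diagonal, trace_diagonal]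
  exact Finset.sum_congr rfl fun k _ => by ring

lemma eigenvalues_le_one {M : Matrix n n ℂ} (hM : M.IsHermitian) (hM' : (1 - M).PosSemidef)
    (k : n) : hM.eigenvalues k ≤ 1 := by
  have h := (hM'.conjTranspose_mul_mul_same (hM.eigenvectorUnitary : Matrix n n ℂ)).diag_nonneg
    (i := k)
  have hV := eigenvectorUnitary_conjTranspose_mul hM
  have e := isHermitian_eq_conj_diagonal hM
  set V := (hM.eigenvectorUnitary : Matrix n n ℂ)
  set D := diagonal (fun i => (hM.eigenvalues i : ℂ)) with hD
  have e' : Vᴴ * (1 - M) * V = 1 - D := by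
    conv_lhs => rw [e]
    calc Vᴴ * (1 - V * D * Vᴴ) * V = Vᴴ * V - (Vᴴ * V) * D * (Vᴴ * V) := by noncomm_ring
      _ = _ := by rw [hV, one_mul, mul_one]
  rw [e'] at h
  simp only [Matrix.sub_apply, one_apply_eq, hD, diagonal_apply_eq] at h
  have := (Complex.le_def.mp h).1
  simp at this
  linarith

lemma sum_comp_equiv_coe {m I M : Type*} [Fintype m] [AddCommMonoid M] {S : Finset I} (e : m ≃ S)
    (g : I → M) : ∑ j, g (e j) = ∑ s ∈ S, g s := by
  rw [← Finset.sum_coe_sort S g]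
  exact e.sum_comp fun s : S => g s

lemma re_trace_conjTranspose_mul_self {m : Type*} [Fintype m] (X : Matrix m m ℂ) :
    (Xᴴ * X).trace.re = ∑ j, (star (X.col j) ⬝ᵥ X.col j).re := by
  simp [trace, Matrix.mul_apply, dotProduct, Complex.re_sum]

/-- If `u` is close to `√t • v` for a unit eigenvector `v` of `0 ≤ N ≤ 1` with eigenvalue `t`, then
`⟨u| 1 - N |u⟩` is small. -/
lemma quadForm_one_sub_le {N : Matrix n n ℂ} (hN : N.PosSemidef) (hN' : (1 - N).PosSemidef)
    {v : n → ℂ} {t : ℝ} (ht : 0 ≤ t) (hv : star v ⬝ᵥ v = 1) (hNv : N *ᵥ v = (t : ℂ) • v)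
    (u : n → ℂ) :
    (star u ⬝ᵥ (1 - N) *ᵥ u).re ≤
      2 * (star (u - (Real.sqrt t : ℂ) • v) ⬝ᵥ (u - (Real.sqrt t : ℂ) • v)).re
        + 2 * (t * (1 - t)) := by
  set w := (Real.sqrt t : ℂ) • v with hw
  have h₁ := quadForm_add_le hN' (u - w) w
  rw [sub_add_cancel] at h₁
  have h₂ : (star (u - w) ⬝ᵥ (1 - N) *ᵥ (u - w)).re ≤ (star (u - w) ⬝ᵥ (u - w)).re := by
    have h : 0 ≤ (star (u - w) ⬝ᵥ N *ᵥ (u - w)).re := hN.re_dotProduct_nonneg (u - w)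
    rw [sub_mulVec, one_mulVec, dotProduct_sub, Complex.sub_re]
    linarith
  have h₃ : (star w ⬝ᵥ (1 - N) *ᵥ w).re = t * (1 - t) := by
    have e : star w ⬝ᵥ (1 - N) *ᵥ w = ((t * (1 - t) : ℝ) : ℂ) := by
      have hs : (Real.sqrt t : ℂ) * (Real.sqrt t : ℂ) = t := by
        rw [← Complex.ofReal_mul, Real.mul_self_sqrt ht]
      rw [hw, mulVec_smul, sub_mulVec, one_mulVec, hNv, star_smul, smul_dotProduct,
        dotProduct_smul, dotProduct_sub, dotProduct_smul, hv]
      simp only [Complex.star_def, Complex.conj_ofReal, smul_eq_mul, mul_one]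
      rw [← mul_assoc, hs]
      push_cast
      ring
    rw [e, Complex.ofReal_re]
  linarith

/-- Every POVM is close to a projective measurement, with squared Frobenius distance controlled by
its projectivity defect. -/
lemma exists_projMeas_close {A : 𝒜 → Matrix n n ℂ} (hA : IsPOVM A) :
    ∃ Q : 𝒜 → Matrix n n ℂ, IsProjMeas Q ∧
      ∑ a, ((A a - Q a) * (A a - Q a)).trace.re ≤ 7 * ∑ a, (A a - A a * A a).trace.re := by
  classical
  rcases isEmpty_or_nonempty n with hn | hn
  · exact ⟨fun _ => 0, ⟨fun a => ⟨Subsingleton.elim _ _, Subsingleton.elim _ _⟩,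
      Subsingleton.elim _ _⟩, by simp [trace]⟩
  have h𝒜 : Nonempty 𝒜 := by
    by_contra h
    rw [not_nonempty_iff] at h
    have := hA.2
    rw [Finset.univ_eq_empty, Finset.sum_empty] at this
    exact zero_ne_one this
  have hH : ∀ a, (A a).IsHermitian := fun a => (hA.1 a).isHermitian
  let f : 𝒜 × n → ℝ := fun s => (hH s.1).eigenvalues s.2
  let v : 𝒜 × n → n → ℂ := fun s => ⇑((hH s.1).eigenvectorBasis s.2)
  have hf₀ : ∀ s, 0 ≤ f s := fun s => (hA.1 s.1).eigenvalues_nonneg s.2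
  have hf₁ : ∀ s, f s ≤ 1 := fun s => eigenvalues_le_one _ (hA.one_sub_posSemidef s.1) s.2
  have hfsum : ∑ s, f s = Fintype.card n := by
    have : ∑ a, (A a).trace = (Fintype.card n : ℂ) := by
      rw [← trace_sum, hA.2, trace_one]
    have e : ∀ a, (A a).trace = ∑ k, ((f (a, k) : ℝ) : ℂ) := fun a =>
      (hH a).trace_eq_sum_eigenvalues
    simp_rw [e] at this
    rw [Fintype.sum_prod_type]
    exact_mod_cast this
  obtain ⟨S, hS, htop⟩ := exists_top_finset f (d := Fintype.card n) (by
    rw [Fintype.card_prod]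
    exact Nat.le_mul_of_pos_left _ Fintype.card_pos)
  have hη := sum_one_sub_le_of_top hf₀ hf₁ htop (by rw [hfsum, hS])
  set ε : ℝ := ∑ s, f s * (1 - f s) with hε
  let e : n ≃ S := Fintype.equivOfCardEq (by simp [hS])
  let W : Matrix n n ℂ := Matrix.of fun i j => (Real.sqrt (f (e j)) : ℂ) * v (e j) i
  have hWW : W * Wᴴ = ∑ s ∈ S, (f s : ℂ) • vecMulVec (v s) (star (v s)) := by
    rw [← sum_comp_equiv_coe e fun s => (f s : ℂ) • vecMulVec (v s) (star (v s))]
    ext i k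
    simp only [Matrix.mul_apply, conjTranspose_apply, W, of_apply, Matrix.sum_apply,
      Matrix.smul_apply, vecMulVec_apply, Pi.star_apply, smul_eq_mul, star_mul',
      Complex.star_def, Complex.conj_ofReal]
    refine Finset.sum_congr rfl fun j _ => ?_
    have hs : (Real.sqrt (f (e j)) : ℂ) * (Real.sqrt (f (e j)) : ℂ) = f (e j) := by
      rw [← Complex.ofReal_mul, Real.mul_self_sqrt (hf₀ _)]
    rw [← hs]
    ring
  have hone : (1 : Matrix n n ℂ) = ∑ s, (f s : ℂ) • vecMulVec (v s) (star (v s)) := by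
    rw [← hA.2, Fintype.sum_prod_type]
    exact Finset.sum_congr rfl fun a _ => sum_vecMulVec_eq (hH a)
  have hpsd : (1 - W * Wᴴ).PosSemidef := by
    rw [hWW, hone, ← Finset.sum_add_sum_compl S, add_sub_cancel_left]
    exact posSemidef_sum _ fun s _ => (posSemidef_vecMulVec_self_star (v s)).smul
      (Complex.zero_le_real.mpr (hf₀ s))
  have hnorm : ∀ s, star (v s) ⬝ᵥ v s = 1 := fun s => by
    have := orthonormal_iff_ite.mp (hH s.1).eigenvectorBasis.orthonormal s.2 s.2
    rw [if_pos rfl, EuclideanSpace.inner_eq_star_dotProduct] at this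
    rw [dotProduct_comm]
    exact this
  have htrW : (1 - W * Wᴴ).trace.re = ∑ s ∈ S, (1 - f s) := by
    rw [trace_sub, trace_one, hWW, trace_sum, Finset.sum_sub_distrib, Finset.sum_const, hS]
    simp only [trace_smul, trace_vecMulVec, Complex.sub_re, Complex.re_sum, nsmul_eq_mul]
    simp [dotProduct_comm (v _), hnorm]
  obtain ⟨U, hU, hU', hUW⟩ := exists_unitary_close W hpsd
  rw [htrW, re_trace_conjTranspose_mul_self] at hUW
  let D : 𝒜 → Matrix n n ℂ := fun a => diagonal fun j => if (e j : 𝒜 × n).1 = a then 1 else 0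
  have hDD : ∀ a, D a * D a = D a := fun a => by
    simp [D, diagonal_mul_diagonal]
  have hDH : ∀ a, (D a)ᴴ = D a := fun a => by
    simp only [D, diagonal_conjTranspose]
    congr 1; ext j; simp only [Pi.star_apply]; split_ifs <;> simp
  have hDsum : ∑ a, D a = 1 := by
    ext i j
    simp only [Matrix.sum_apply, D, diagonal_apply, one_apply]
    split_ifs <;> simp
  let Q : 𝒜 → Matrix n n ℂ := fun a => U * D a * Uᴴ
  have hQQ : ∀ a, Q a * Q a = Q a := fun a => by
    calc Q a * Q a = U * (D a * (Uᴴ * U) * D a) * Uᴴ := by simp only [Q, Matrix.mul_assoc]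
      _ = Q a := by rw [hU, mul_one, hDD]
  have hQsum : ∑ a, Q a = 1 := by
    simp only [Q]
    rw [← Finset.sum_mul, ← Finset.mul_sum, hDsum, mul_one, hU']
  refine ⟨Q, ⟨fun a => ⟨by simp [Q, hDH, Matrix.mul_assoc], hQQ a⟩, hQsum⟩, ?_⟩
  have hAQ : ∑ a, (A a * Q a).trace.re =
      Fintype.card n - ∑ j, (star (U.col j) ⬝ᵥ (1 - A (e j : 𝒜 × n).1) *ᵥ U.col j).re := by
    have h₁ : ∀ a, (A a * Q a).trace = ∑ j, if (e j : 𝒜 × n).1 = a then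
        star (U.col j) ⬝ᵥ A (e j : 𝒜 × n).1 *ᵥ U.col j else 0 := by
      intro a
      have : (A a * Q a).trace = (Uᴴ * A a * U * D a).trace := by
        calc (A a * Q a).trace = ((A a * U * D a) * Uᴴ).trace := by
              simp only [Q, Matrix.mul_assoc]
          _ = _ := by rw [trace_mul_comm]; simp only [Matrix.mul_assoc]
      rw [this, trace]
      refine Finset.sum_congr rfl fun j _ => ?_
      rw [diag_apply, mul_diagonal]
      split_ifs with h
      · rw [h, mul_one, Matrix.mul_assoc, Matrix.mul_apply]
        rfl
      · rw [mul_zero]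
    have h₂ : ∀ j, (star (U.col j) ⬝ᵥ (1 - A (e j : 𝒜 × n).1) *ᵥ U.col j).re =
        1 - (star (U.col j) ⬝ᵥ A (e j : 𝒜 × n).1 *ᵥ U.col j).re := by
      intro j
      have hu : star (U.col j) ⬝ᵥ U.col j = 1 := by
        have := congrFun (congrFun hU j) j
        rw [one_apply_eq] at this
        exact this
      rw [sub_mulVec, one_mulVec, dotProduct_sub, hu, Complex.sub_re, Complex.one_re]
    simp_rw [h₂, h₁]
    rw [← Complex.re_sum, Finset.sum_comm]
    simp [Complex.re_sum]
  have hmain : ∑ j, (star (U.col j) ⬝ᵥ (1 - A (e j : 𝒜 × n).1) *ᵥ U.col j).re ≤ 4 * ε := by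
    have h₁ : ∀ j, (star (U.col j) ⬝ᵥ (1 - A (e j : 𝒜 × n).1) *ᵥ U.col j).re ≤
        2 * (star ((U - W).col j) ⬝ᵥ (U - W).col j).re + 2 * (f (e j) * (1 - f (e j))) := by
      intro j
      exact quadForm_one_sub_le (hA.1 _) (hA.one_sub_posSemidef _) (hf₀ (e j)) (hnorm (e j))
        ((hH _).mulVec_eigenvectorBasis _) (U.col j)
    have h₂ : ∑ j, f (e j) * (1 - f (e j)) ≤ ε := by
      rw [sum_comp_equiv_coe e fun s => f s * (1 - f s)]
      exact Finset.sum_le_univ_sum_of_nonneg fun s =>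
        mul_nonneg (hf₀ s) (sub_nonneg.mpr (hf₁ s))
    have h₃ := Finset.sum_le_sum fun j (_ : j ∈ Finset.univ) => h₁ j
    rw [Finset.sum_add_distrib, ← Finset.mul_sum, ← Finset.mul_sum] at h₃
    linarith
  have hA₁ : ∑ a, (A a).trace.re = Fintype.card n := by
    rw [← Complex.re_sum, ← trace_sum, hA.2, trace_one, Complex.natCast_re]
  have hQ₁ : ∑ a, (Q a).trace.re = Fintype.card n := by
    rw [← Complex.re_sum, ← trace_sum, hQsum, trace_one, Complex.natCast_re]
  have hA₂ : ∑ a, (A a * A a).trace.re = ∑ s, f s ^ 2 := by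
    rw [Fintype.sum_prod_type]
    refine Finset.sum_congr rfl fun a _ => ?_
    rw [trace_mul_self_eq_sum_eigenvalues (hH a), Complex.re_sum]
    exact Finset.sum_congr rfl fun k _ => by rw [← Complex.ofReal_pow, Complex.ofReal_re]
  have hε' : ε = Fintype.card n - ∑ s, f s ^ 2 := by
    rw [hε, ← hfsum, ← Finset.sum_sub_distrib]
    exact Finset.sum_congr rfl fun s _ => by ring
  have hlhs : ∑ a, ((A a - Q a) * (A a - Q a)).trace.re =
      ∑ a, (A a * A a).trace.re + ∑ a, (Q a).trace.re - 2 * ∑ a, (A a * Q a).trace.re := by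
    rw [Finset.mul_sum, ← Finset.sum_add_distrib, ← Finset.sum_sub_distrib]
    refine Finset.sum_congr rfl fun a _ => ?_
    have : (A a - Q a) * (A a - Q a) = A a * A a - A a * Q a - Q a * A a + Q a * Q a := by
      noncomm_ring
    rw [this, hQQ, trace_add, trace_sub, trace_sub, trace_mul_comm (Q a) (A a)]
    simp only [Complex.add_re, Complex.sub_re]
    ring
  have hrhs : ∑ a, (A a - A a * A a).trace.re = ε := by
    simp only [trace_sub, Complex.sub_re, Finset.sum_sub_distrib]
    rw [hA₁, hA₂, hε']
  rw [hlhs, hrhs, hAQ, hA₂, hQ₁]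
  linarith

/-- Compression of `exists_projMeas_close` to the range of the isometry `E`. -/
lemma exists_projMeasOn_close {m : Type*} [Fintype m] [DecidableEq m] {A : 𝒜 → Matrix n n ℂ}
    (hA : IsPOVM A) {E : Matrix n m ℂ} (hE : Eᴴ * E = 1) :
    ∃ Q : 𝒜 → Matrix n n ℂ, IsProjMeasOn (E * Eᴴ) Q ∧
      ∑ a, ((A a - Q a) * (A a - Q a) * (E * Eᴴ)).trace.re ≤
        7 * ∑ a, (Eᴴ * (A a - A a * A a) * E).trace.re +
        8 * ∑ a, (Eᴴ * (A a * (1 - E * Eᴴ) * A a) * E).trace.re := by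
  have hE' : ∀ X : Matrix m m ℂ, Eᴴ * (E * X) = X := fun X => by
    rw [← Matrix.mul_assoc, hE, one_mul]
  obtain ⟨q, hq, hle⟩ := exists_projMeas_close (A := fun a => Eᴴ * A a * E)
    ⟨fun a => (hA.1 a).conjTranspose_mul_mul_same E, by
      beta_reduce
      rw [← Matrix.sum_mul, ← Matrix.mul_sum, hA.2, Matrix.mul_one, hE]⟩
  refine ⟨fun a => E * q a * Eᴴ, ⟨fun a => ⟨?_, ?_, ?_, ?_⟩, ?_⟩, ?_⟩
  · simp [(hq.1 a).1, Matrix.mul_assoc]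
  · calc E * q a * Eᴴ * (E * q a * Eᴴ) = E * (q a * (Eᴴ * E) * q a) * Eᴴ := by
          simp only [Matrix.mul_assoc]
      _ = _ := by rw [hE, mul_one, (hq.1 a).2]
  · calc E * Eᴴ * (E * q a * Eᴴ) = E * ((Eᴴ * E) * q a) * Eᴴ := by simp only [Matrix.mul_assoc]
      _ = _ := by rw [hE, one_mul]
  · calc E * q a * Eᴴ * (E * Eᴴ) = E * q a * (Eᴴ * E) * Eᴴ := by simp only [Matrix.mul_assoc]
      _ = _ := by rw [hE, Matrix.mul_one]
  · beta_reduce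
    rw [← Matrix.sum_mul, ← Matrix.mul_sum, hq.2, Matrix.mul_one]
  · have e₁ : ∀ a, ((A a - E * q a * Eᴴ) * (A a - E * q a * Eᴴ) * (E * Eᴴ)).trace =
        ((Eᴴ * A a * E - q a) * (Eᴴ * A a * E - q a)).trace +
          (Eᴴ * (A a * (1 - E * Eᴴ) * A a) * E).trace := by
      intro a
      rw [← Matrix.mul_assoc, trace_mul_comm, ← trace_add]
      congr 1
      simp only [Matrix.mul_sub, Matrix.sub_mul, Matrix.mul_assoc, hE, hE', Matrix.mul_one]
      abel
    have e₂ : ∀ a, (Eᴴ * A a * E - Eᴴ * A a * E * (Eᴴ * A a * E)).trace =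
        (Eᴴ * (A a - A a * A a) * E).trace + (Eᴴ * (A a * (1 - E * Eᴴ) * A a) * E).trace := by
      intro a
      rw [← trace_add]
      congr 1
      simp only [Matrix.mul_sub, Matrix.sub_mul, Matrix.mul_assoc, Matrix.mul_one]
      abel
    simp only [e₂] at hle
    simp only [e₁, Complex.add_re, Finset.sum_add_distrib] at hle ⊢
    linarith

lemma IsPOVM.conj {A : 𝒜 → Matrix n n ℂ} (hA : IsPOVM A) {V : Matrix n n ℂ} (hV : Vᴴ * V = 1) :
    IsPOVM fun a => Vᴴ * A a * V :=
  ⟨fun a => (hA.1 a).conjTranspose_mul_mul_same V, by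
    rw [← Finset.sum_mul, ← Finset.mul_sum, hA.2, mul_one, hV]⟩

lemma mul_self_apply_diag {m : Type*} [Fintype m] {M : Matrix m m ℂ} (hM : M.IsHermitian) (j : m) :
    ((M * M) j j).re = ∑ i, Complex.normSq (M i j) := by
  rw [Matrix.mul_apply, Complex.re_sum]
  refine Finset.sum_congr rfl fun i _ => ?_
  rw [← hM.apply j i, Complex.star_def, ← Complex.normSq_eq_conj_mul_self, Complex.ofReal_re]

lemma sum_normSq_col_le {M : Matrix n n ℂ} (hM : M.PosSemidef) (hM' : (1 - M).PosSemidef) (j : n) :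
    ∑ i, Complex.normSq (M i j) ≤ (M j j).re := by
  have h := (posSemidef_sub_mul_self hM hM').diag_nonneg (i := j)
  have h' := (Complex.le_def.mp h).1
  rw [Matrix.sub_apply, Complex.sub_re, mul_self_apply_diag hM.isHermitian] at h'
  simpa using h'

lemma sum_normSq_mul_sq_le {A : 𝒜 → Matrix n n ℂ} (hA : ∀ a, (A a).PosSemidef)
    (hA' : (1 - ∑ a, A a).PosSemidef) {s : n → ℝ} (hs : ∑ i, s i ^ 2 = 1) :
    ∑ a, ∑ j, ∑ i, Complex.normSq (A a i j) * s j ^ 2 ≤ 1 := by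
  classical
  have h1 : ∀ a, (1 - A a).PosSemidef := fun a => by
    have e : 1 - A a = (1 - ∑ b, A b) + ∑ b ∈ Finset.univ.erase a, A b := by
      rw [← Finset.add_sum_erase _ _ (Finset.mem_univ a)]; abel
    rw [e]
    exact hA'.add (posSemidef_sum _ fun b _ => hA b)
  calc ∑ a, ∑ j, ∑ i, Complex.normSq (A a i j) * s j ^ 2
      ≤ ∑ a, ∑ j, (A a j j).re * s j ^ 2 := by
        refine Finset.sum_le_sum fun a _ => Finset.sum_le_sum fun j _ => ?_
        rw [← Finset.sum_mul]
        exact mul_le_mul_of_nonneg_right (sum_normSq_col_le (hA a) (h1 a) j) (sq_nonneg _)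
    _ = ∑ j, (∑ a, A a j j).re * s j ^ 2 := by
        rw [Finset.sum_comm]
        exact Finset.sum_congr rfl fun j _ => by rw [Complex.re_sum, Finset.sum_mul]
    _ ≤ ∑ j, s j ^ 2 := by
        refine Finset.sum_le_sum fun j _ => ?_
        have h := (Complex.le_def.mp (hA'.diag_nonneg (i := j))).1
        rw [Matrix.sub_apply, one_apply_eq, Matrix.sum_apply] at h
        simp only [Complex.zero_re, Complex.sub_re, Complex.one_re] at h
        exact mul_le_of_le_one_left (sq_nonneg _) (by linarith)
    _ = 1 := hs

/-- Symmetric weights `N` on pairs whose overlap with `s ⊗ s` is almost maximal are concentrated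
near the diagonal. -/
lemma sum_mul_abs_sq_sub_sq_le {m : Type*} [Fintype m] {N : 𝒜 → m → m → ℝ}
    (hN : ∀ a i j, 0 ≤ N a i j) (hsymm : ∀ a i j, N a i j = N a j i) {s : m → ℝ}
    (hs : ∀ i, 0 ≤ s i) {δ : ℝ}
    (hγ : ∑ a, ∑ j, ∑ i, N a i j * s j ^ 2 ≤ 1)
    (hα : 1 - 2 * δ ≤ ∑ a, ∑ j, ∑ i, N a i j * (s i * s j)) :
    0 ≤ δ ∧ 1 - ∑ a, ∑ j, ∑ i, N a i j * s j ^ 2 ≤ 2 * Real.sqrt δ ∧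
      ∑ a, ∑ j, ∑ i, N a i j * |s i ^ 2 - s j ^ 2| ≤ 4 * Real.sqrt δ := by
  set γ := ∑ a, ∑ j, ∑ i, N a i j * s j ^ 2 with hγdef
  set α := ∑ a, ∑ j, ∑ i, N a i j * (s i * s j) with hαdef
  have hγ' : ∑ a, ∑ j, ∑ i, N a i j * s i ^ 2 = γ := by
    refine Finset.sum_congr rfl fun a _ => ?_
    rw [Finset.sum_comm]
    exact Finset.sum_congr rfl fun i _ => Finset.sum_congr rfl fun j _ => by rw [hsymm]
  have hsub : ∑ a, ∑ j, ∑ i, N a i j * (s i - s j) ^ 2 = 2 * γ - 2 * α := by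
    have : 2 * γ - 2 * α = γ + γ - 2 * α := by ring
    rw [this]
    conv_rhs => enter [1, 1]; rw [← hγ']
    simp only [hγdef, hαdef, Finset.mul_sum, ← Finset.sum_add_distrib, ← Finset.sum_sub_distrib]
    refine Finset.sum_congr rfl fun a _ => Finset.sum_congr rfl fun j _ =>
      Finset.sum_congr rfl fun i _ => by ring
  have hadd : ∑ a, ∑ j, ∑ i, N a i j * (s i + s j) ^ 2 = 2 * γ + 2 * α := by
    have : 2 * γ + 2 * α = γ + γ + 2 * α := by ring
    rw [this]
    conv_rhs => enter [1, 1]; rw [← hγ']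
    simp only [hγdef, hαdef, Finset.mul_sum, ← Finset.sum_add_distrib]
    refine Finset.sum_congr rfl fun a _ => Finset.sum_congr rfl fun j _ =>
      Finset.sum_congr rfl fun i _ => by ring
  have hsub0 : 0 ≤ ∑ a, ∑ j, ∑ i, N a i j * (s i - s j) ^ 2 :=
    Finset.sum_nonneg fun a _ => Finset.sum_nonneg fun j _ => Finset.sum_nonneg fun i _ =>
      mul_nonneg (hN a i j) (sq_nonneg _)
  have hγ0 : 0 ≤ γ :=
    Finset.sum_nonneg fun a _ => Finset.sum_nonneg fun j _ => Finset.sum_nonneg fun i _ =>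
      mul_nonneg (hN a i j) (sq_nonneg _)
  have hδ : 0 ≤ δ := by linarith
  refine ⟨hδ, ?_, ?_⟩
  · have h := Real.sqrt_nonneg δ
    have h' := Real.sq_sqrt hδ
    rcases le_total (Real.sqrt δ) 1 with h1 | h1 <;> nlinarith
  · have hcs := Real.sum_mul_le_sqrt_mul_sqrt (Finset.univ : Finset (𝒜 × m × m))
      (fun p => Real.sqrt (N p.1 p.2.2 p.2.1) * |s p.2.2 - s p.2.1|)
      (fun p => Real.sqrt (N p.1 p.2.2 p.2.1) * (s p.2.2 + s p.2.1))
    simp only [Fintype.sum_prod_type, mul_pow, Real.sq_sqrt (hN _ _ _), sq_abs, hsub, hadd] at hcs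
    have e : ∀ a j i, Real.sqrt (N a i j) * |s i - s j| * (Real.sqrt (N a i j) * (s i + s j)) =
        N a i j * |s i ^ 2 - s j ^ 2| := by
      intro a j i
      rw [sq_sub_sq, abs_mul, abs_of_nonneg (add_nonneg (hs i) (hs j)), mul_mul_mul_comm,
        Real.mul_self_sqrt (hN a i j)]
      ring
    simp only [e] at hcs
    refine hcs.trans ?_
    have h₁ : Real.sqrt (2 * γ - 2 * α) ≤ 2 * Real.sqrt δ := by
      refine (Real.sqrt_le_sqrt (by linarith : _ ≤ 2 ^ 2 * δ)).trans_eq ?_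
      rw [Real.sqrt_mul (by norm_num), Real.sqrt_sq (by norm_num)]
    have h₂ : Real.sqrt (2 * γ + 2 * α) ≤ 2 := by
      refine (Real.sqrt_le_sqrt (by linarith : _ ≤ (2 : ℝ) ^ 2)).trans_eq ?_
      rw [Real.sqrt_sq (by norm_num)]
    nlinarith [Real.sqrt_nonneg (2 * γ - 2 * α), Real.sqrt_nonneg (2 * γ + 2 * α),
      Real.sqrt_nonneg δ]

/-- A POVM `A` that is almost perfectly correlated with a sub-POVM `B` on the state with Schmidt
coefficients `s` is almost projective and almost commutes with the reduced density. -/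
lemma almost_commute_of_correlated {A B : 𝒜 → Matrix n n ℂ} (hA : IsPOVM A)
    (hB : ∀ a, (B a).PosSemidef) (hB' : (1 - ∑ a, B a).PosSemidef) {s : n → ℝ}
    (hs : ∀ i, 0 ≤ s i) (hs1 : ∑ i, s i ^ 2 = 1) {δ : ℝ}
    (hδ : 1 - δ ≤ ∑ a, ∑ j, ∑ i, (A a i j * B a j i).re * (s i * s j)) :
    0 ≤ δ ∧ ∑ a, ∑ j, ((A a - A a * A a) j j).re * s j ^ 2 ≤ 2 * Real.sqrt δ ∧
      ∑ a, ∑ j, ∑ i, Complex.normSq (A a i j) * |s i ^ 2 - s j ^ 2| ≤ 4 * Real.sqrt δ := by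
  have hsymm : ∀ {C : Matrix n n ℂ}, C.PosSemidef → ∀ i j,
      Complex.normSq (C i j) = Complex.normSq (C j i) := fun hC i j => by
    rw [← hC.isHermitian.apply i j, Complex.star_def, Complex.normSq_conj]
  have hγ := sum_normSq_mul_sq_le hA.1 (by rw [hA.2, sub_self]; exact PosSemidef.zero) hs1
  have hβ := sum_normSq_mul_sq_le hB hB' hs1
  have hβ' : ∑ a, ∑ j, ∑ i, Complex.normSq (B a j i) * s i ^ 2 ≤ 1 := by
    refine le_trans (le_of_eq (Finset.sum_congr rfl fun a _ => ?_)) hβ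
    rw [Finset.sum_comm]
  have hterm : ∀ a j i, 2 * ((A a i j * B a j i).re * (s i * s j)) ≤
      Complex.normSq (A a i j) * (s i * s j) + (Complex.normSq (B a i j) * s j ^ 2 +
        Complex.normSq (B a j i) * s i ^ 2) / 2 := by
    intro a j i
    have h₁ : 2 * (A a i j * B a j i).re ≤
        Complex.normSq (A a i j) + Complex.normSq (B a j i) := by
      rw [Complex.mul_re, Complex.normSq_apply, Complex.normSq_apply]
      nlinarith [sq_nonneg ((A a i j).re - (B a j i).re), sq_nonneg ((A a i j).im + (B a j i).im)]
    have h₂ := mul_le_mul_of_nonneg_right h₁ (mul_nonneg (hs i) (hs j))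
    have h₃ := mul_nonneg (Complex.normSq_nonneg (B a j i)) (sq_nonneg (s i - s j))
    rw [hsymm (hB a) i j]
    nlinarith
  have hα : 1 - 2 * δ ≤ ∑ a, ∑ j, ∑ i, Complex.normSq (A a i j) * (s i * s j) := by
    have h := Finset.sum_le_sum fun a (_ : a ∈ Finset.univ) => Finset.sum_le_sum fun j
      (_ : j ∈ Finset.univ) => Finset.sum_le_sum fun i (_ : i ∈ Finset.univ) => hterm a j i
    simp only [Finset.sum_add_distrib, ← Finset.sum_div, ← Finset.mul_sum] at h
    simp only [Finset.mul_sum, ← Finset.sum_mul] at h hβ hβ' hδ ⊢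
    simp only [← Finset.mul_sum] at h
    linarith
  obtain ⟨h₀, h₁, h₂⟩ := sum_mul_abs_sq_sub_sq_le
    (fun a i j => Complex.normSq_nonneg (A a i j)) (fun a => hsymm (hA.1 a)) hs hγ hα
  refine ⟨h₀, le_trans (le_of_eq ?_) h₁, h₂⟩
  have hone : ∑ a, ∑ j, (A a j j).re * s j ^ 2 = 1 := by
    rw [Finset.sum_comm, ← hs1]
    refine Finset.sum_congr rfl fun j _ => ?_
    have := congrArg Complex.re (congrFun (congrFun hA.2 j) j)
    rw [Matrix.sum_apply, Complex.re_sum, one_apply_eq, Complex.one_re] at this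
    rw [← Finset.sum_mul, this, one_mul]
  rw [← hone, ← Finset.sum_sub_distrib]
  refine Finset.sum_congr rfl fun a _ => ?_
  rw [← Finset.sum_sub_distrib]
  refine Finset.sum_congr rfl fun j _ => ?_
  rw [Matrix.sub_apply, Complex.sub_re, mul_self_apply_diag (hA.1 a).isHermitian, sub_mul,
    Finset.sum_mul]

end Matrices

section LevelSets

variable {n : Type*} [Fintype n] [DecidableEq n]

lemma integrableOn_ite_le (l : ℝ) :
    IntegrableOn (fun t : ℝ => if t ≤ l then (1 : ℝ) else 0) (Set.Ioi 0) := by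
  have e : (fun t : ℝ => if t ≤ l then (1 : ℝ) else 0) = (Set.Iic l).indicator fun _ => 1 := by
    ext t; simp [Set.indicator_apply]
  rw [e, IntegrableOn, integrable_indicator_iff measurableSet_Iic, IntegrableOn,
    Measure.restrict_restrict measurableSet_Iic, Set.inter_comm, Set.Ioi_inter_Iic]
  exact integrableOn_const (by simp)

lemma integral_ite_le {l : ℝ} (hl : 0 ≤ l) :
    ∫ t in Set.Ioi (0 : ℝ), (if t ≤ l then (1 : ℝ) else 0) = l := by
  have e : (fun t : ℝ => if t ≤ l then (1 : ℝ) else 0) = (Set.Iic l).indicator fun _ => 1 := by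
    ext t; simp [Set.indicator_apply]
  rw [e, integral_indicator measurableSet_Iic, Measure.restrict_restrict measurableSet_Iic,
    Set.inter_comm, Set.Ioi_inter_Iic]
  simp [hl]

/-- A function of the superlevel set `{i | t ≤ l i}` that vanishes on `∅` is integrable in
`t > 0`. -/
lemma integrableOn_superlevel (l : n → ℝ) {g : Finset n → ℝ} (hg : g ∅ = 0) :
    IntegrableOn (fun t : ℝ => g (Finset.univ.filter fun i => t ≤ l i)) (Set.Ioi 0) := by
  have e : (fun t : ℝ => g (Finset.univ.filter fun i => t ≤ l i)) = fun t => ∑ T ∈ Finset.univ,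
      {t : ℝ | ∀ i, i ∈ T ↔ t ≤ l i}.indicator (fun _ => g T) t := by
    ext t
    rw [Finset.sum_eq_single (Finset.univ.filter fun i => t ≤ l i)]
    · simp
    · intro T _ hT
      refine Set.indicator_of_notMem (fun h => hT ?_) _
      ext i
      simpa using h i
    · simp
  have hmeas : ∀ T : Finset n, MeasurableSet {t : ℝ | ∀ i, i ∈ T ↔ t ≤ l i} := fun T => by
    have e : {t : ℝ | ∀ i, i ∈ T ↔ t ≤ l i} =
        ⋂ i, (if i ∈ T then Set.Iic (l i) else Set.Ioi (l i)) := by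
      ext t
      rw [Set.mem_iInter]
      refine forall_congr' fun i => ?_
      split_ifs with h <;> simp [h]
    rw [e]
    refine MeasurableSet.iInter fun i => ?_
    split_ifs
    exacts [measurableSet_Iic, measurableSet_Ioi]
  rw [e]
  refine integrable_finsetSum _ fun T _ => ?_
  rcases T.eq_empty_or_nonempty with rfl | ⟨i, hi⟩
  · simp [hg]
  · rw [integrable_indicator_iff (hmeas T), IntegrableOn, Measure.restrict_restrict (hmeas T)]
    refine integrableOn_const (ne_of_lt (lt_of_le_of_lt (measure_mono ?_)
      (measure_Ioc_lt_top (a := (0 : ℝ)) (b := l i))))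
    exact fun t ht => ⟨ht.2, (ht.1 i).mp hi⟩

lemma integral_sum_superlevel {m : Type*} [Fintype m] {l : m → ℝ} (hl : ∀ i, 0 ≤ l i) (u : m → ℝ) :
    ∫ t in Set.Ioi (0 : ℝ), ∑ j ∈ Finset.univ.filter (fun i => t ≤ l i), u j = ∑ j, u j * l j := by
  have e : ∀ t : ℝ, ∑ j ∈ Finset.univ.filter (fun i => t ≤ l i), u j =
      ∑ j, u j * (if t ≤ l j then 1 else 0) := fun t => by
    rw [Finset.sum_filter]
    exact Finset.sum_congr rfl fun j _ => by simp
  simp_rw [e]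
  rw [integral_finsetSum _ fun j _ => (integrableOn_ite_le (l j)).const_mul (u j)]
  exact Finset.sum_congr rfl fun j _ => by rw [integral_const_mul, integral_ite_le (hl j)]

lemma integral_sum_boundary_le {l : n → ℝ} (hl : ∀ i, 0 ≤ l i) {N : n → n → ℝ}
    (hN : ∀ i j, 0 ≤ N i j) :
    ∫ t in Set.Ioi (0 : ℝ), ∑ j ∈ Finset.univ.filter (fun i => t ≤ l i),
      ∑ i ∈ (Finset.univ.filter fun i => t ≤ l i)ᶜ, N i j ≤ ∑ j, ∑ i, N i j * |l i - l j| := by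
  have e : ∀ t : ℝ, ∑ j ∈ Finset.univ.filter (fun i => t ≤ l i),
      ∑ i ∈ (Finset.univ.filter fun i => t ≤ l i)ᶜ, N i j = ∑ j, ∑ i,
        N i j * ((if t ≤ l j then 1 else 0) - (if t ≤ min (l i) (l j) then 1 else 0)) := by
    intro t
    rw [Finset.sum_filter]
    refine Finset.sum_congr rfl fun j _ => ?_
    rw [Finset.compl_filter, Finset.sum_filter]
    split_ifs with h
    · refine Finset.sum_congr rfl fun i _ => ?_
      by_cases h' : t ≤ l i <;> simp [h, h']
    · simp [h]
  simp_rw [e]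
  have hint : ∀ i j, IntegrableOn (fun t : ℝ => N i j * ((if t ≤ l j then (1 : ℝ) else 0) -
      (if t ≤ min (l i) (l j) then 1 else 0))) (Set.Ioi 0) := fun i j =>
    ((integrableOn_ite_le (l j)).sub (integrableOn_ite_le (min (l i) (l j)))).const_mul (N i j)
  rw [integral_finsetSum _ fun j _ => integrable_finsetSum _ fun i _ => hint i j]
  refine Finset.sum_le_sum fun j _ => ?_
  rw [integral_finsetSum _ fun i _ => hint i j]
  refine Finset.sum_le_sum fun i _ => ?_
  rw [integral_const_mul, integral_sub (integrableOn_ite_le (l j)) (integrableOn_ite_le _),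
    integral_ite_le (hl j), integral_ite_le (le_min (hl i) (hl j))]
  refine mul_le_mul_of_nonneg_left ?_ (hN i j)
  rcases le_total (l i) (l j) with h | h
  · rw [min_eq_left h, abs_sub_comm]; exact le_abs_self _
  · rw [min_eq_right h, sub_self]; exact abs_nonneg _

/-- The columns of the eigenvector matrix indexed by `T`. -/
noncomputable def eigenCols {M : Matrix n n ℂ} (hM : M.IsHermitian) (T : Finset n) :
    Matrix n T ℂ :=
  (hM.eigenvectorUnitary : Matrix n n ℂ).submatrix id Subtype.val

lemma conjTranspose_eigenCols_mul {M : Matrix n n ℂ} (hM : M.IsHermitian) (T : Finset n)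
    (X : Matrix n n ℂ) : (eigenCols hM T)ᴴ * X * eigenCols hM T =
      ((hM.eigenvectorUnitary : Matrix n n ℂ)ᴴ * X *
        (hM.eigenvectorUnitary : Matrix n n ℂ)).submatrix Subtype.val Subtype.val := by
  ext i j
  rfl

lemma eigenCols_isometry {M : Matrix n n ℂ} (hM : M.IsHermitian) (T : Finset n) :
    (eigenCols hM T)ᴴ * eigenCols hM T = 1 := by
  have h := conjTranspose_eigenCols_mul hM T 1
  rw [Matrix.mul_one, Matrix.mul_one, eigenvectorUnitary_conjTranspose_mul] at h
  rw [h, submatrix_one _ Subtype.val_injective]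

lemma eigenCols_mul_conjTranspose {M : Matrix n n ℂ} (hM : M.IsHermitian) (T : Finset n) :
    eigenCols hM T * (eigenCols hM T)ᴴ = (hM.eigenvectorUnitary : Matrix n n ℂ) *
      diagonal (fun i => if i ∈ T then (1 : ℂ) else 0) *
        (hM.eigenvectorUnitary : Matrix n n ℂ)ᴴ := by
  ext i j
  rw [Matrix.mul_apply, Matrix.mul_apply]
  simp only [mul_diagonal, conjTranspose_apply, eigenCols, submatrix_apply, id, mul_ite, mul_one,
    mul_zero, ite_mul, zero_mul]
  rw [← Finset.sum_filter, Finset.filter_univ_mem]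
  exact Finset.sum_coe_sort T fun k => (hM.eigenvectorUnitary : Matrix n n ℂ) i k *
    star ((hM.eigenvectorUnitary : Matrix n n ℂ) j k)

lemma specProj_eq {M : Matrix n n ℂ} (hM : M.IsHermitian) (t : ℝ) :
    specProj hM t = eigenCols hM (Finset.univ.filter fun i => t ≤ hM.eigenvalues i) *
      (eigenCols hM (Finset.univ.filter fun i => t ≤ hM.eigenvalues i))ᴴ := by
  have e : specProj hM t = (hM.eigenvectorUnitary : Matrix n n ℂ) *
      diagonal (RCLike.ofReal ∘ (fun x : ℝ => if t ≤ x then (1 : ℝ) else 0) ∘ hM.eigenvalues) *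
        (hM.eigenvectorUnitary : Matrix n n ℂ)ᴴ := rfl
  rw [eigenCols_mul_conjTranspose, e]
  congr 3
  ext i
  by_cases h : t ≤ hM.eigenvalues i <;> simp [h]

lemma integral_specProj {M : Matrix n n ℂ} (hM : M.PosSemidef) :
    ∫ t in Set.Ioi (0 : ℝ), specProj hM.isHermitian t = M := by
  set V := (hM.isHermitian.eigenvectorUnitary : Matrix n n ℂ) with hV
  set l := hM.isHermitian.eigenvalues with hl
  have e : ∀ t, specProj hM.isHermitian t = ∑ k, (if t ≤ l k then (1 : ℝ) else 0) •
      vecMulVec (V.col k) (star (V.col k)) := by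
    intro t
    rw [specProj_eq, eigenCols_mul_conjTranspose]
    ext i j
    rw [Matrix.mul_apply]
    simp only [mul_diagonal, conjTranspose_apply, Matrix.sum_apply, Matrix.smul_apply,
      vecMulVec_apply, Finset.mem_filter, Finset.mem_univ, true_and, Pi.star_apply, col_apply]
    refine Finset.sum_congr rfl fun k _ => ?_
    rw [← hV, ← hl]
    split_ifs
    · rw [mul_one, one_smul]
    · rw [mul_zero, zero_mul, zero_smul]
  simp_rw [e]
  rw [integral_finsetSum _ fun k _ => (integrableOn_ite_le (l k)).smul_const _]
  simp_rw [integral_smul_const]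
  conv_rhs => rw [isHermitian_eq_conj_diagonal hM.isHermitian]
  ext i j
  rw [Matrix.mul_apply]
  simp only [mul_diagonal, conjTranspose_apply, Matrix.sum_apply, Matrix.smul_apply,
    vecMulVec_apply, Pi.star_apply, col_apply]
  refine Finset.sum_congr rfl fun k _ => ?_
  rw [integral_ite_le (hM.eigenvalues_nonneg k), Complex.real_smul, ← hV, ← hl]
  ring

lemma trace_submatrix_val {m : Type*} (T : Finset m) (X : Matrix m m ℂ) :
    (X.submatrix (Subtype.val : T → m) Subtype.val).trace = ∑ j ∈ T, X j j :=
  Finset.sum_coe_sort T fun j => X j j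

end LevelSets

section Strategies

variable {n₁ n₂ 𝒜 : Type*} [Fintype n₁] [Fintype n₂]

lemma rhoA_eq_mul_conjTranspose {m₁ m₂ : Type*} [Fintype m₂] (ψ : m₁ × m₂ → ℂ) :
    rhoA ψ = (Matrix.of fun i j => ψ (i, j)) * (Matrix.of fun i j => ψ (i, j))ᴴ :=
  rfl

lemma rhoA_posSemidef (ψ : n₁ × n₂ → ℂ) : (rhoA ψ).PosSemidef := by
  rw [rhoA_eq_mul_conjTranspose]
  exact posSemidef_self_mul_conjTranspose _

lemma trace_rhoA (ψ : n₁ × n₂ → ℂ) : (rhoA ψ).trace = nsq ψ := by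
  rw [nsq, Fintype.sum_prod_type, Complex.ofReal_sum]
  refine Finset.sum_congr rfl fun i _ => ?_
  rw [Complex.ofReal_sum]
  exact Finset.sum_congr rfl fun j _ => Complex.mul_conj _

lemma ev_kronecker (ψ : n₁ × n₂ → ℂ) (A : Matrix n₁ n₁ ℂ) (B : Matrix n₂ n₂ ℂ) :
    ev ψ (A ⊗ₖ B) = ((Matrix.of fun i j => ψ (i, j))ᴴ * A * (Matrix.of fun i j => ψ (i, j)) *
      Bᵀ).trace.re := by
  rw [ev]
  congr 1
  simp only [dotProduct, mulVec, Fintype.sum_prod_type, Matrix.trace, diag_apply, Matrix.mul_apply,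
    transpose_apply, conjTranspose_apply, of_apply, kroneckerMap_apply, Pi.star_apply,
    Finset.mul_sum, Finset.sum_mul]
  rw [Finset.sum_comm]
  refine Finset.sum_congr rfl fun j _ => ?_
  have e : ∀ F : n₁ → n₁ → n₂ → ℂ, ∑ i, ∑ k, ∑ l, F i k l = ∑ l, ∑ k, ∑ i, F i k l := by
    intro F
    rw [Finset.sum_comm, Finset.sum_comm_cycle]
  rw [e]
  refine Finset.sum_congr rfl fun l _ => Finset.sum_congr rfl fun k _ =>
    Finset.sum_congr rfl fun i _ => by ring

lemma ev_swap (ψ : n₁ × n₂ → ℂ) (A : Matrix n₁ n₁ ℂ) (B : Matrix n₂ n₂ ℂ) :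
    ev (fun p : n₂ × n₁ => ψ p.swap) (B ⊗ₖ A) = ev ψ (A ⊗ₖ B) := by
  rw [ev, ev, dotProduct, dotProduct, ← (Equiv.prodComm n₁ n₂).sum_comp]
  congr 1
  refine Finset.sum_congr rfl fun p _ => ?_
  rw [mulVec, mulVec, dotProduct, dotProduct, ← (Equiv.prodComm n₁ n₂).sum_comp]
  simp [kroneckerMap_apply, mul_comm]

lemma deltaSync_swap {𝒳 : Type*} [Fintype 𝒳] [Fintype 𝒜] [DecidableEq 𝒜] (ν : 𝒳 → ℝ)
    (ψ : n₁ × n₂ → ℂ) (A : 𝒳 → 𝒜 → Matrix n₁ n₁ ℂ) (B : 𝒳 → 𝒜 → Matrix n₂ n₂ ℂ) :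
    deltaSync ν (fun p : n₂ × n₁ => ψ p.swap) B A = deltaSync ν ψ A B := by
  simp only [deltaSync, ev_swap]
  refine Finset.sum_congr rfl fun x _ => ?_
  rw [Finset.sum_comm]
  simp only [eq_comm]

lemma sum_ev_eq_one_sub [DecidableEq n₁] [DecidableEq n₂] [Fintype 𝒜] [DecidableEq 𝒜]
    {ψ : n₁ × n₂ → ℂ} (hψ : nsq ψ = 1) {A : 𝒜 → Matrix n₁ n₁ ℂ} {B : 𝒜 → Matrix n₂ n₂ ℂ}
    (hA : IsPOVM A) (hB : IsPOVM B) :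
    ∑ a, ev ψ (A a ⊗ₖ B a) = 1 - ∑ a, ∑ b, if a = b then 0 else ev ψ (A a ⊗ₖ B b) := by
  have h : ∑ a, ∑ b, ev ψ (A a ⊗ₖ B b) = 1 := by
    simp only [ev_kronecker, ← Complex.re_sum, ← trace_sum, ← Matrix.mul_sum, ← transpose_sum, hB.2,
      ← Matrix.sum_mul, hA.2]
    rw [transpose_one, Matrix.mul_one, Matrix.mul_one, trace_mul_comm, ← rhoA_eq_mul_conjTranspose,
      trace_rhoA, hψ, Complex.ofReal_one, Complex.one_re]
  rw [← h, ← Finset.sum_sub_distrib]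
  refine Finset.sum_congr rfl fun a _ => ?_
  rw [← Finset.sum_sub_distrib]
  rw [Finset.sum_eq_single a]
  · rw [if_pos rfl, sub_zero]
  · intro b _ hb
    rw [if_neg hb.symm, sub_self]
  · simp

/-- A matrix with orthogonal rows is a diagonal matrix times a partial isometry. -/
lemma exists_diagonal_mul [DecidableEq n₁] {K : Matrix n₁ n₂ ℂ} {l : n₁ → ℝ} (hl : ∀ i, 0 ≤ l i)
    (hK : K * Kᴴ = diagonal fun i => (l i : ℂ)) :
    ∃ R : Matrix n₁ n₂ ℂ, K = diagonal (fun i => (Real.sqrt (l i) : ℂ)) * R ∧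
      (1 - R * Rᴴ).PosSemidef := by
  refine ⟨diagonal (fun i => ((Real.sqrt (l i))⁻¹ : ℂ)) * K, ?_, ?_⟩
  · rw [← Matrix.mul_assoc, diagonal_mul_diagonal]
    ext i j
    rw [diagonal_mul]
    rcases (hl i).eq_or_lt with h | h
    · have h0 : (K * Kᴴ) i i = 0 := by rw [hK, diagonal_apply_eq, ← h, Complex.ofReal_zero]
      have h1 : ∑ j, Complex.normSq (K i j) = 0 := by
        rw [Matrix.mul_apply] at h0
        have := congrArg Complex.re h0
        rw [Complex.re_sum] at this
        simpa [Complex.normSq_apply] using this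
      have h2 := (Finset.sum_eq_zero_iff_of_nonneg fun j _ => Complex.normSq_nonneg _).mp h1 j
        (Finset.mem_univ j)
      rw [Complex.normSq_eq_zero.mp h2, mul_zero]
    · have : (Real.sqrt (l i) : ℂ) ≠ 0 := by exact_mod_cast (Real.sqrt_pos.mpr h).ne'
      rw [mul_inv_cancel₀ this, one_mul]
  · have e : diagonal (fun i => ((Real.sqrt (l i))⁻¹ : ℂ)) * K *
        (diagonal (fun i => ((Real.sqrt (l i))⁻¹ : ℂ)) * K)ᴴ =
          diagonal fun i => (((Real.sqrt (l i))⁻¹ * l i * (Real.sqrt (l i))⁻¹ : ℝ) : ℂ) := by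
      rw [conjTranspose_mul, Matrix.mul_assoc, ← Matrix.mul_assoc K, hK, diagonal_conjTranspose,
        diagonal_mul_diagonal, diagonal_mul_diagonal]
      congr 1
      ext i
      simp [mul_assoc]
    rw [e, ← diagonal_one, diagonal_sub]
    refine PosSemidef.diagonal fun i => ?_
    have h : (Real.sqrt (l i))⁻¹ * l i * (Real.sqrt (l i))⁻¹ ≤ 1 := by
      rcases (hl i).eq_or_lt with h | h
      · simp [← h]
      · have hp := Real.sqrt_pos.mpr h
        refine le_of_eq ?_
        nth_rw 2 [← Real.mul_self_sqrt h.le]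
        field_simp
    rw [Pi.zero_apply, sub_nonneg]
    exact Complex.real_le_real.mpr h

/-- In an almost synchronous strategy the measurement on the first factor is almost projective and
almost commutes with the reduced density. -/
lemma almost_commute_of_sync [DecidableEq n₁] [DecidableEq n₂] [Fintype 𝒜] [DecidableEq 𝒜]
    {ψ : n₁ × n₂ → ℂ} (hψ : nsq ψ = 1) {A : 𝒜 → Matrix n₁ n₁ ℂ} {B : 𝒜 → Matrix n₂ n₂ ℂ}
    (hA : IsPOVM A) (hB : IsPOVM B) {δ : ℝ}
    (hδ : δ = ∑ a, ∑ b, if a = b then 0 else ev ψ (A a ⊗ₖ B b))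
    {V : Matrix n₁ n₁ ℂ} (hV : V = (rhoA_isHermitian ψ).eigenvectorUnitary) {l : n₁ → ℝ}
    (hl : l = (rhoA_isHermitian ψ).eigenvalues) :
    0 ≤ δ ∧ ∑ a, ∑ j, ((Vᴴ * (A a - A a * A a) * V) j j).re * l j ≤ 2 * Real.sqrt δ ∧
      ∑ a, ∑ j, ∑ i, Complex.normSq ((Vᴴ * A a * V) i j) * |l i - l j| ≤ 4 * Real.sqrt δ := by
  have hVV : Vᴴ * V = 1 := by rw [hV]; exact eigenvectorUnitary_conjTranspose_mul _
  have hVV' : V * Vᴴ = 1 := by rw [hV]; exact eigenvectorUnitary_mul_conjTranspose _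
  have hl0 : ∀ i, 0 ≤ l i := fun i => by rw [hl]; exact (rhoA_posSemidef ψ).eigenvalues_nonneg i
  have hρ : rhoA ψ = V * diagonal (fun i => (l i : ℂ)) * Vᴴ := by
    rw [hV, hl]; exact isHermitian_eq_conj_diagonal _
  have hs2 : ∀ i, Real.sqrt (l i) ^ 2 = l i := fun i => Real.sq_sqrt (hl0 i)
  have hl1 : ∑ i, Real.sqrt (l i) ^ 2 = 1 := by
    simp only [hs2]
    have h := trace_rhoA ψ
    rw [hρ, trace_mul_comm, ← Matrix.mul_assoc, hVV, Matrix.one_mul, trace_diagonal, hψ] at h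
    exact_mod_cast h
  obtain ⟨R, hR, hR1⟩ := exists_diagonal_mul (K := Vᴴ * Matrix.of fun i j => ψ (i, j)) hl0 (by
    rw [conjTranspose_mul, conjTranspose_conjTranspose, Matrix.mul_assoc, ← Matrix.mul_assoc _ _ V,
      ← rhoA_eq_mul_conjTranspose, hρ, ← Matrix.mul_assoc, ← Matrix.mul_assoc,
      ← Matrix.mul_assoc, hVV, Matrix.one_mul, Matrix.mul_assoc, hVV, Matrix.mul_one])
  set D : Matrix n₁ n₁ ℂ := diagonal fun i => (Real.sqrt (l i) : ℂ) with hD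
  have hDD : Dᴴ = D := by
    rw [hD, diagonal_conjTranspose]
    congr 1
    ext i
    simp
  have hK : (Matrix.of fun i j => ψ (i, j)) = V * (D * R) := by
    rw [← hR, ← Matrix.mul_assoc, hVV', Matrix.one_mul]
  have hev : ∀ a, ev ψ (A a ⊗ₖ B a) = ∑ j, ∑ i, ((Vᴴ * A a * V) i j *
      (R * (B a)ᵀ * Rᴴ) j i).re * (Real.sqrt (l i) * Real.sqrt (l j)) := by
    intro a
    have e : ((V * (D * R))ᴴ * A a * (V * (D * R)) * (B a)ᵀ).trace =
        (D * (Vᴴ * A a * V) * D * (R * (B a)ᵀ * Rᴴ)).trace := by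
      rw [conjTranspose_mul, conjTranspose_mul, hDD]
      simp only [Matrix.mul_assoc]
      rw [trace_mul_comm]
      simp only [Matrix.mul_assoc]
    rw [ev_kronecker, hK, e, Finset.sum_comm, Matrix.trace, Complex.re_sum]
    refine Finset.sum_congr rfl fun i _ => ?_
    rw [diag_apply, Matrix.mul_apply, Complex.re_sum]
    refine Finset.sum_congr rfl fun j _ => ?_
    rw [hD, mul_diagonal, diagonal_mul, ← Complex.re_mul_ofReal, Complex.ofReal_mul]
    congr 1
    ring
  have h := almost_commute_of_correlated (hA.conj hVV) (B := fun a => R * (B a)ᵀ * Rᴴ)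
    (fun a => ((hB.1 a).transpose).mul_mul_conjTranspose_same R) (by
      rw [← Matrix.sum_mul, ← Matrix.mul_sum, ← transpose_sum, hB.2, transpose_one, Matrix.mul_one]
      exact hR1) (s := fun i => Real.sqrt (l i)) (fun i => Real.sqrt_nonneg _) hl1 (δ := δ) (by
      simp only [← hev]
      rw [sum_ev_eq_one_sub hψ hA hB, hδ])
  simp only [hs2] at h
  have e : ∀ a, Vᴴ * (A a - A a * A a) * V =
      Vᴴ * A a * V - Vᴴ * A a * V * (Vᴴ * A a * V) := fun a => by
    rw [Matrix.mul_sub, Matrix.sub_mul]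
    congr 1
    calc Vᴴ * (A a * A a) * V = Vᴴ * A a * 1 * A a * V := by
          simp only [Matrix.mul_assoc, Matrix.one_mul]
      _ = _ := by rw [← hVV']; simp only [Matrix.mul_assoc]
  simp only [e]
  exact h

end Strategies

section LevelSetMeasurements

variable {n 𝒜 : Type*} [Fintype n] [DecidableEq n]

lemma trace_mul_normalized {P : Matrix n n ℂ} (hP : P.PosSemidef) (X : Matrix n n ℂ) :
    (X * (P.trace⁻¹ • P)).trace.re * P.trace.re = (X * P).trace.re := by
  have him : P.trace.im = 0 := (Complex.le_def.mp hP.trace_nonneg).2.symm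
  by_cases h : P.trace = 0
  · rw [hP.trace_eq_zero_iff.mp h]; simp
  · have e : P.trace = (P.trace.re : ℂ) := Complex.ext rfl (by simpa using him)
    rw [← Complex.re_mul_ofReal, ← e, Matrix.mul_smul, trace_smul, smul_eq_mul, mul_right_comm,
      inv_mul_cancel₀ h, one_mul]

/-- An almost projective POVM that almost commutes with `M` is close to projective measurements
supported on the superlevel spectral subspaces of `M`. -/
lemma exists_projMeasOn_superlevel [Fintype 𝒜] {M : Matrix n n ℂ} (hM : M.PosSemidef)
    {A : 𝒜 → Matrix n n ℂ} (hA : IsPOVM A) {V : Matrix n n ℂ}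
    (hV : V = hM.isHermitian.eigenvectorUnitary) {l : n → ℝ}
    (hl : l = hM.isHermitian.eigenvalues) {d : ℝ}
    (h₁ : ∑ a, ∑ j, ((Vᴴ * (A a - A a * A a) * V) j j).re * l j ≤ 2 * d)
    (h₂ : ∑ a, ∑ j, ∑ i, Complex.normSq ((Vᴴ * A a * V) i j) * |l i - l j| ≤ 4 * d) :
    ∃ Q : ℝ → 𝒜 → Matrix n n ℂ, (∀ t, IsProjMeasOn (specProj hM.isHermitian t) (Q t)) ∧
      ∑ a, (∫ t in Set.Ioi (0 : ℝ), (((A a - Q t a) * (A a - Q t a)) *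
        ((specProj hM.isHermitian t).trace⁻¹ • specProj hM.isHermitian t)).trace.re *
          (specProj hM.isHermitian t).trace.re) ≤ 46 * d := by
  have hl0 : ∀ i, 0 ≤ l i := fun i => by rw [hl]; exact hM.eigenvalues_nonneg i
  have hVV' : V * Vᴴ = 1 := by rw [hV]; exact eigenvectorUnitary_mul_conjTranspose _
  choose Q hQ hle using fun T => exists_projMeasOn_close hA (eigenCols_isometry hM.isHermitian T)
  have hcols : ∀ (T : Finset n) X, (eigenCols hM.isHermitian T)ᴴ * X * eigenCols hM.isHermitian T =
      (Vᴴ * X * V).submatrix Subtype.val Subtype.val := fun T X => by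
    rw [conjTranspose_eigenCols_mul, hV]
  have hbd : ∀ T a, ((eigenCols hM.isHermitian T)ᴴ * (A a * (1 - eigenCols hM.isHermitian T *
      (eigenCols hM.isHermitian T)ᴴ) * A a) * eigenCols hM.isHermitian T).trace.re =
        ∑ j ∈ T, ∑ i ∈ Tᶜ, Complex.normSq ((Vᴴ * A a * V) i j) := by
    intro T a
    have e : Vᴴ * (A a * (1 - eigenCols hM.isHermitian T * (eigenCols hM.isHermitian T)ᴴ) * A a) *
        V = (Vᴴ * A a * V)ᴴ * diagonal (fun i => if i ∈ Tᶜ then (1 : ℂ) else 0) *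
          (Vᴴ * A a * V) := by
      have e' : 1 - eigenCols hM.isHermitian T * (eigenCols hM.isHermitian T)ᴴ =
          V * diagonal (fun i => if i ∈ Tᶜ then (1 : ℂ) else 0) * Vᴴ := by
        have e'' : diagonal (fun i => if i ∈ Tᶜ then (1 : ℂ) else 0) =
            1 - diagonal (fun i => if i ∈ T then (1 : ℂ) else 0) := by
          rw [← diagonal_one, diagonal_sub]
          congr 1
          ext i
          by_cases h : i ∈ T <;> simp [h]
        rw [eigenCols_mul_conjTranspose, ← hV, e'', Matrix.mul_sub, Matrix.sub_mul, Matrix.mul_one,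
          hVV']
      rw [e', conjTranspose_mul, conjTranspose_mul, conjTranspose_conjTranspose,
        (hA.1 a).isHermitian.eq]
      simp only [Matrix.mul_assoc]
    rw [hcols, trace_submatrix_val, e, Complex.re_sum]
    refine Finset.sum_congr rfl fun j _ => ?_
    rw [Matrix.mul_apply, Complex.re_sum, ← Finset.sum_subset (Finset.subset_univ Tᶜ)]
    · refine Finset.sum_congr rfl fun i hi => ?_
      rw [mul_diagonal, if_pos hi, mul_one, conjTranspose_apply, Complex.star_def,
        ← Complex.normSq_eq_conj_mul_self, Complex.ofReal_re]
    · intro i _ hi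
      rw [mul_diagonal, if_neg hi, mul_zero, zero_mul, Complex.zero_re]
  have hpr : ∀ T a, ((eigenCols hM.isHermitian T)ᴴ * (A a - A a * A a) *
      eigenCols hM.isHermitian T).trace.re =
        ∑ j ∈ T, ((Vᴴ * (A a - A a * A a) * V) j j).re := by
    intro T a
    rw [hcols, trace_submatrix_val, Complex.re_sum]
  simp only [hbd, hpr] at hle
  have hle' : ∀ T : Finset n, ∑ a, ((A a - Q T a) * (A a - Q T a) * (eigenCols hM.isHermitian T *
      (eigenCols hM.isHermitian T)ᴴ)).trace.re ≤
        7 * ∑ j ∈ T, (∑ a, ((Vᴴ * (A a - A a * A a) * V) j j).re) +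
        8 * ∑ j ∈ T, ∑ i ∈ Tᶜ, ∑ a, Complex.normSq ((Vᴴ * A a * V) i j) := by
    intro T
    refine (hle T).trans_eq ?_
    rw [Finset.sum_comm]
    congr 2
    rw [Finset.sum_comm]
    exact Finset.sum_congr rfl fun j _ => Finset.sum_comm
  have hempty : eigenCols hM.isHermitian ∅ * (eigenCols hM.isHermitian ∅)ᴴ = 0 := by
    simp [eigenCols_mul_conjTranspose]
  have hint : ∀ a, IntegrableOn (fun t : ℝ =>
      ((A a - Q (Finset.univ.filter fun i => t ≤ l i) a) *
        (A a - Q (Finset.univ.filter fun i => t ≤ l i) a) *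
          (eigenCols hM.isHermitian (Finset.univ.filter fun i => t ≤ l i) *
            (eigenCols hM.isHermitian (Finset.univ.filter fun i => t ≤ l i))ᴴ)).trace.re)
      (Set.Ioi 0) := fun a =>
    integrableOn_superlevel l (g := fun T => ((A a - Q T a) * (A a - Q T a) *
      (eigenCols hM.isHermitian T * (eigenCols hM.isHermitian T)ᴴ)).trace.re) (by
        rw [hempty, Matrix.mul_zero, trace_zero, Complex.zero_re])
  have hint₁ : IntegrableOn (fun t : ℝ => ∑ j ∈ Finset.univ.filter (fun i => t ≤ l i),
      ∑ a, ((Vᴴ * (A a - A a * A a) * V) j j).re) (Set.Ioi 0) :=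
    integrableOn_superlevel l (g := fun T => ∑ j ∈ T,
      ∑ a, ((Vᴴ * (A a - A a * A a) * V) j j).re) Finset.sum_empty
  have hint₂ : IntegrableOn (fun t : ℝ => ∑ j ∈ Finset.univ.filter (fun i => t ≤ l i),
      ∑ i ∈ (Finset.univ.filter fun i => t ≤ l i)ᶜ,
        ∑ a, Complex.normSq ((Vᴴ * A a * V) i j)) (Set.Ioi 0) :=
    integrableOn_superlevel l (g := fun T => ∑ j ∈ T, ∑ i ∈ Tᶜ,
      ∑ a, Complex.normSq ((Vᴴ * A a * V) i j)) Finset.sum_empty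
  refine ⟨fun t => Q (Finset.univ.filter fun i => t ≤ l i), fun t => ?_, ?_⟩
  · rw [specProj_eq, ← hl]
    exact hQ _
  have hpos : ∀ t, (specProj hM.isHermitian t).PosSemidef := fun t => by
    rw [specProj_eq]
    exact posSemidef_self_mul_conjTranspose _
  have hspec : ∀ t, specProj hM.isHermitian t =
      eigenCols hM.isHermitian (Finset.univ.filter fun i => t ≤ l i) *
        (eigenCols hM.isHermitian (Finset.univ.filter fun i => t ≤ l i))ᴴ := fun t => by
    rw [specProj_eq, hl]
  simp only [trace_mul_normalized (hpos _)]
  simp only [hspec]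
  rw [← integral_finsetSum _ fun a _ => hint a]
  refine (setIntegral_mono (integrable_finsetSum _ fun a _ => hint a)
    ((hint₁.const_mul 7).add (hint₂.const_mul 8)) fun t => hle' _).trans ?_
  simp only [Pi.add_apply]
  rw [integral_add (hint₁.const_mul 7) (hint₂.const_mul 8), integral_const_mul, integral_const_mul,
    integral_sum_superlevel hl0]
  have h₃ := integral_sum_boundary_le hl0 (N := fun i j =>
    ∑ a, Complex.normSq ((Vᴴ * A a * V) i j)) fun i j =>
      Finset.sum_nonneg fun a _ => Complex.normSq_nonneg _
  have h₁' : ∑ j, (∑ a, ((Vᴴ * (A a - A a * A a) * V) j j).re) * l j ≤ 2 * d := by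
    simp only [Finset.sum_mul]
    rwa [Finset.sum_comm]
  have h₂' : ∑ j, ∑ i, (∑ a, Complex.normSq ((Vᴴ * A a * V) i j)) * |l i - l j| ≤ 4 * d := by
    refine le_trans (le_of_eq ?_) h₂
    rw [Finset.sum_comm]
    simp only [Finset.sum_mul]
    rw [Finset.sum_comm_cycle]
    exact Finset.sum_congr rfl fun a _ => Finset.sum_comm
  linarith

lemma sum_mul_sqrt_le {𝒳 : Type*} [Fintype 𝒳] {ν d : 𝒳 → ℝ} (hν : IsDist ν) (hd : ∀ x, 0 ≤ d x) :
    ∑ x, ν x * Real.sqrt (d x) ≤ Real.sqrt (∑ x, ν x * d x) := by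
  have h := Real.sum_sqrt_mul_sqrt_le Finset.univ hν.1 fun x => mul_nonneg (hν.1 x) (hd x)
  rw [hν.2, Real.sqrt_one, one_mul] at h
  refine le_trans (le_of_eq (Finset.sum_congr rfl fun x _ => ?_)) h
  rw [Real.sqrt_mul (hν.1 x), ← mul_assoc, Real.mul_self_sqrt (hν.1 x)]

/-- The measurements on the first factor of an almost synchronous strategy are close to projective
measurements supported on the superlevel spectral subspaces of the reduced density. -/
lemma exists_projMeasOn_of_sync {n₁ n₂ 𝒳 : Type*} [Fintype n₁] [DecidableEq n₁] [Fintype n₂]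
    [DecidableEq n₂] [Fintype 𝒳] [Fintype 𝒜] [DecidableEq 𝒜] {ψ : n₁ × n₂ → ℂ} (hψ : nsq ψ = 1)
    {A : 𝒳 → 𝒜 → Matrix n₁ n₁ ℂ} {B : 𝒳 → 𝒜 → Matrix n₂ n₂ ℂ}
    (hA : ∀ x, IsPOVM (A x)) (hB : ∀ x, IsPOVM (B x)) {ν : 𝒳 → ℝ} (hν : IsDist ν) :
    ∃ Al : ℝ → 𝒳 → 𝒜 → Matrix n₁ n₁ ℂ,
      (∀ t, 0 < t → ∀ x, IsProjMeasOn (specProj (rhoA_isHermitian ψ) t) (Al t x)) ∧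
      ∑ x, ν x * ∑ a, (∫ t in Set.Ioi (0:ℝ),
        ((((A x a - Al t x a) * (A x a - Al t x a)) *
            (((specProj (rhoA_isHermitian ψ) t).trace)⁻¹ •
              specProj (rhoA_isHermitian ψ) t)).trace).re *
          (specProj (rhoA_isHermitian ψ) t).trace.re)
        ≤ 46 * deltaSync ν ψ A B ^ (1 / 2 : ℝ) := by
  have h := fun x => almost_commute_of_sync hψ (hA x) (hB x) rfl rfl rfl
  choose Q hQ hle using fun x =>
    exists_projMeasOn_superlevel (rhoA_posSemidef ψ) (hA x) rfl rfl (h x).2.1 (h x).2.2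
  refine ⟨fun t x => Q x t, fun t _ x => hQ x t, ?_⟩
  refine (Finset.sum_le_sum fun x _ => mul_le_mul_of_nonneg_left (hle x) (hν.1 x)).trans ?_
  rw [← Real.sqrt_eq_rpow, deltaSync]
  simp only [mul_left_comm _ (46 : ℝ), ← Finset.mul_sum]
  exact mul_le_mul_of_nonneg_left (sum_mul_sqrt_le hν fun x => (h x).1) (by norm_num)

end LevelSetMeasurements

/-- the main theorem for a general (not necessarily symmetric) strategy:
the conclusions hold for the `A` measurements with the spectral subspaces of `ρ_A`, and
analogously for the `B` measurements with `ρ_B`. -/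
theorem stmt10 :
    ∃ c C : ℝ, 0 < c ∧ 0 < C ∧
    ∀ (n₁ n₂ : ℕ) (𝒳 𝒜 : Type) [Fintype 𝒳] [Fintype 𝒜] [DecidableEq 𝒜]
      (ψ : Fin n₁ × Fin n₂ → ℂ) (_hψ : nsq ψ = 1)
      (A : 𝒳 → 𝒜 → Matrix (Fin n₁) (Fin n₁) ℂ)
      (B : 𝒳 → 𝒜 → Matrix (Fin n₂) (Fin n₂) ℂ)
      (_hA : ∀ x, IsPOVM (A x)) (_hB : ∀ x, IsPOVM (B x))
      (ν : 𝒳 → ℝ) (_hν : IsDist ν)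
      (δ : ℝ) (_hδ : δ = deltaSync ν ψ A B),
      ((∫ t in Set.Ioi (0:ℝ), specProj (rhoA_isHermitian ψ) t) = rhoA ψ)
      ∧ (∃ Al : ℝ → 𝒳 → 𝒜 → Matrix (Fin n₁) (Fin n₁) ℂ,
          (∀ t, 0 < t → ∀ x, IsProjMeasOn (specProj (rhoA_isHermitian ψ) t) (Al t x)) ∧
          ∑ x, ν x * ∑ a,
              (∫ t in Set.Ioi (0:ℝ),
                ((((A x a - Al t x a) * (A x a - Al t x a)) *
                    (((specProj (rhoA_isHermitian ψ) t).trace)⁻¹ •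
                      specProj (rhoA_isHermitian ψ) t)).trace).re *
                  (specProj (rhoA_isHermitian ψ) t).trace.re)
            ≤ C * δ ^ c)
      ∧ ((∫ t in Set.Ioi (0:ℝ), specProj (rhoB_isHermitian ψ) t) = rhoB ψ)
      ∧ (∃ Bl : ℝ → 𝒳 → 𝒜 → Matrix (Fin n₂) (Fin n₂) ℂ,
          (∀ t, 0 < t → ∀ x, IsProjMeasOn (specProj (rhoB_isHermitian ψ) t) (Bl t x)) ∧
          ∑ x, ν x * ∑ a,
              (∫ t in Set.Ioi (0:ℝ),
                ((((B x a - Bl t x a) * (B x a - Bl t x a)) *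
                    (((specProj (rhoB_isHermitian ψ) t).trace)⁻¹ •
                      specProj (rhoB_isHermitian ψ) t)).trace).re *
                  (specProj (rhoB_isHermitian ψ) t).trace.re)
            ≤ C * δ ^ c) := by
  refine ⟨1 / 2, 46, by norm_num, by norm_num, ?_⟩
  rintro n₁ n₂ 𝒳 𝒜 _ _ _ ψ hψ A B hA hB ν hν δ rfl
  have hψ' : nsq (fun p : Fin n₂ × Fin n₁ => ψ p.swap) = 1 := by
    rw [← hψ, nsq, nsq, ← (Equiv.prodComm (Fin n₁) (Fin n₂)).sum_comp]
    rfl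
  refine ⟨integral_specProj (rhoA_posSemidef ψ), exists_projMeasOn_of_sync hψ hA hB hν,
    integral_specProj (rhoA_posSemidef fun p : Fin n₂ × Fin n₁ => ψ p.swap), ?_⟩
  rw [← deltaSync_swap]
  exact exists_projMeasOn_of_sync hψ' hB hA hν

end AlmostSync
end
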